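/- arXiv:2007.05752 — 4 statements merged into one kernel-verified Lean document; each statement's English description precedes it below -/
import Mathlib

section
/- Let V ⊂ ℝ be open and u ∈ BV_loc(V). If N ⊂ V is a set containing no approximate discontinuity point of u (N ∩ S_u = ∅) and |Du|(N) = 0, then the image ũ(N) of N under the precise (Lebesgue) representative ũ of u has one-dimensional Lebesgue measure zero. -/
open MeasureTheory Metric Set Filter Topology
open scoped ENNReal NNReal
noncomputable section

/-- The total variation of `u : ℝ → ℝ` on `U`, by duality with `C¹_c` test functions. -/
noncomputable def variation1 (u : ℝ → ℝ) (U : Set ℝ) : ℝ≥0∞ :=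
  ⨆ (φ : ℝ → ℝ) (_ : ContDiff ℝ 1 φ) (_ : HasCompactSupport φ)
    (_ : tsupport φ ⊆ U) (_ : ∀ x, |φ x| ≤ 1),
    ENNReal.ofReal (∫ x in U, u x * deriv φ x)

/-- The primitive of a continuous integrable function, normalised to vanish at `-∞`. -/
theorem hasDerivAt_integral_Iic {f : ℝ → ℝ} (hf : Continuous f) (hi : Integrable f) (t : ℝ) :
    HasDerivAt (fun t => ∫ s in Iic t, f s) (f t) t := by
  have h : (fun t => ∫ s in Iic t, f s) =
      fun t => (∫ s in Iic (0 : ℝ), f s) + ∫ s in (0 : ℝ)..t, f s := by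
    ext t
    rw [← intervalIntegral.integral_Iic_sub_Iic hi.integrableOn hi.integrableOn]
    ring
  rw [h]
  exact ((hf.integral_hasStrictDerivAt 0 t).hasDerivAt).const_add _

/-- Differences of two continuous probability densities carried by `Icc a b ⊆ U` are derivatives of
admissible test functions in the definition of the variation on `U`. -/
theorem ofReal_integral_sub_le_variation1 {u f g : ℝ → ℝ} {U : Set ℝ} {a b : ℝ}
    (hab : Icc a b ⊆ U) (hf : Continuous f) (hg : Continuous g)
    (hf0 : ∀ x, 0 ≤ f x) (hg0 : ∀ x, 0 ≤ g x) (hf1 : ∫ x, f x = 1) (hg1 : ∫ x, g x = 1)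
    (hfs : Function.support f ⊆ Icc a b) (hgs : Function.support g ⊆ Icc a b) :
    ENNReal.ofReal (∫ x in U, u x * (f x - g x)) ≤ variation1 u U := by
  have key : ∀ h : ℝ → ℝ, (∀ x, 0 ≤ h x) → ∫ x, h x = 1 → Function.support h ⊆ Icc a b →
      (∀ t, 0 ≤ ∫ s in Iic t, h s) ∧ (∀ t, ∫ s in Iic t, h s ≤ 1) ∧
      (∀ t < a, ∫ s in Iic t, h s = 0) ∧ ∀ t > b, ∫ s in Iic t, h s = 1 := by
    intro h h0 h1 hs
    have hi : Integrable h := by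
      by_contra hn
      simp [integral_undef hn] at h1
    refine ⟨fun t => integral_nonneg h0, fun t => ?_, fun t ht => ?_, fun t ht => ?_⟩
    · exact (setIntegral_le_integral hi (Eventually.of_forall h0)).trans_eq h1
    · refine setIntegral_eq_zero_of_forall_eq_zero fun s hst => ?_
      by_contra hne
      exact absurd (hs hne).1 (not_le.2 (lt_of_le_of_lt hst ht))
    · rw [setIntegral_eq_integral_of_forall_compl_eq_zero, h1]
      intro s hst
      by_contra hne
      exact hst ((hs hne).2.trans ht.le)
  obtain ⟨f2, f3, f4, f5⟩ := key f hf0 hf1 hfs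
  obtain ⟨g2, g3, g4, g5⟩ := key g hg0 hg1 hgs
  have hfi : Integrable f := by
    by_contra hn
    simp [integral_undef hn] at hf1
  have hgi : Integrable g := by
    by_contra hn
    simp [integral_undef hn] at hg1
  let φ : ℝ → ℝ := fun t => (∫ s in Iic t, f s) - ∫ s in Iic t, g s
  have hd : ∀ t, HasDerivAt φ (f t - g t) t := fun t =>
    (hasDerivAt_integral_Iic hf hfi t).sub (hasDerivAt_integral_Iic hg hgi t)
  have hderiv : deriv φ = fun t => f t - g t := funext fun t => (hd t).deriv
  have hsub : tsupport φ ⊆ Icc a b := by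
    refine closure_minimal (fun t ht => ?_) isClosed_Icc
    by_contra hn
    refine ht ?_
    by_cases hta : t < a
    · simp [φ, f4 t hta, g4 t hta]
    · have htb : b < t := by
        by_contra hb
        exact hn ⟨not_lt.1 hta, not_lt.1 hb⟩
      simp [φ, f5 t htb, g5 t htb]
  have hC : ContDiff ℝ 1 φ := by
    rw [contDiff_one_iff_deriv]
    refine ⟨fun t => (hd t).differentiableAt, ?_⟩
    rw [hderiv]
    exact hf.sub hg
  have hcs : HasCompactSupport φ :=
    isCompact_Icc.of_isClosed_subset (isClosed_tsupport φ) hsub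
  have hle : ∀ t, |φ t| ≤ 1 := fun t =>
    abs_le.2 ⟨by linarith [f2 t, g3 t], by linarith [f3 t, g2 t]⟩
  have h : ENNReal.ofReal (∫ x in U, u x * deriv φ x) ≤ variation1 u U :=
    le_iSup_of_le φ <| le_iSup_of_le hC <| le_iSup_of_le hcs <|
      le_iSup_of_le (hsub.trans hab) <| le_iSup_of_le hle le_rfl
  simpa only [hderiv] using h

/-- A bump function centred at `x` with outer radius `r` and inner radius `r / 2`. -/
def halfBump (x : ℝ) {r : ℝ} (hr : 0 < r) : ContDiffBump x :=
  ⟨r / 2, r, half_pos hr, half_lt_self hr⟩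

/-- The normalised smooth bump at `x` of radius `r` (and `0` if `r ≤ 0`). -/
def mollifierAt (x r : ℝ) : ℝ → ℝ :=
  if hr : 0 < r then (halfBump x hr).normed volume else 0

theorem mollifierAt_of_pos (x : ℝ) {r : ℝ} (hr : 0 < r) :
    mollifierAt x r = (halfBump x hr).normed volume := dif_pos hr

theorem continuous_mollifierAt (x : ℝ) {r : ℝ} (hr : 0 < r) : Continuous (mollifierAt x r) := by
  rw [mollifierAt_of_pos x hr]
  exact (halfBump x hr).continuous_normed

theorem mollifierAt_nonneg (x : ℝ) {r : ℝ} (hr : 0 < r) (y : ℝ) : 0 ≤ mollifierAt x r y := by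
  rw [mollifierAt_of_pos x hr]
  exact (halfBump x hr).nonneg_normed y

theorem integral_mollifierAt (x : ℝ) {r : ℝ} (hr : 0 < r) : ∫ y, mollifierAt x r y = 1 := by
  rw [mollifierAt_of_pos x hr]
  exact (halfBump x hr).integral_normed

theorem support_mollifierAt (x : ℝ) {r : ℝ} (hr : 0 < r) :
    Function.support (mollifierAt x r) = ball x r := by
  rw [mollifierAt_of_pos x hr]
  exact (halfBump x hr).support_normed_eq

theorem mollifierAt_le (x : ℝ) {r : ℝ} (hr : 0 < r) (y : ℝ) :
    |mollifierAt x r y| ≤ 2 / volume.real (ball x r) := by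
  rw [abs_of_nonneg (mollifierAt_nonneg x hr y), mollifierAt_of_pos x hr]
  have h := (halfBump x hr).normed_le_div_measure_closedBall_rOut volume 2
    (by simp [halfBump]; linarith) y
  rwa [Module.finrank_self, pow_one, Measure.addHaar_real_closedBall_eq_addHaar_real_ball] at h

/-- Mollifications converge at Lebesgue points. -/
theorem tendsto_integral_mul_mollifierAt {u : ℝ → ℝ} {U : Set ℝ} (hU : IsOpen U)
    (hu : LocallyIntegrableOn u U) {x c : ℝ} (hx : x ∈ U)
    (h : Tendsto (fun r : ℝ => ⨍ y in ball x r, |u y - c| ∂volume) (𝓝[>] (0 : ℝ)) (𝓝 0)) :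
    Tendsto (fun r : ℝ => ∫ y in U, u y * mollifierAt x r y) (𝓝[>] (0 : ℝ)) (𝓝 c) := by
  obtain ⟨ρ, hρ, hρU⟩ := Metric.nhds_basis_closedBall.mem_iff.1 (hU.mem_nhds hx)
  have hpos : ∀ᶠ r : ℝ in 𝓝[>] (0 : ℝ), 0 < r := self_mem_nhdsWithin
  have hlt : ∀ᶠ r : ℝ in 𝓝[>] (0 : ℝ), r < ρ :=
    mem_nhdsWithin_of_mem_nhds (Iio_mem_nhds hρ)
  have hlim : Tendsto (fun r : ℝ => ∫ y, mollifierAt x r y • u y) (𝓝[>] (0 : ℝ)) (𝓝 c) := by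
    refine tendsto_integral_smul_of_tendsto_average_norm_sub (a := fun r => ball x r) 2
      (by simpa only [Real.norm_eq_abs] using h) ?_ ?_ ?_ ?_
    · filter_upwards [hlt] with r hr
      exact (hu.integrableOn_compact_subset hρU (isCompact_closedBall x ρ)).mono_set
        (ball_subset_closedBall.trans (closedBall_subset_closedBall hr.le))
    · refine tendsto_const_nhds.congr' ?_
      filter_upwards [hpos] with r hr using (integral_mollifierAt x hr).symm
    · filter_upwards [hpos] with r hr using (support_mollifierAt x hr).subset
    · filter_upwards [hpos] with r hr using mollifierAt_le x hr
  refine hlim.congr' ?_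
  filter_upwards [hpos, hlt] with r hr hrρ
  rw [setIntegral_eq_integral_of_forall_compl_eq_zero]
  · simp only [smul_eq_mul, mul_comm]
  · intro y hy
    have : mollifierAt x r y = 0 := by
      by_contra hne
      have hm : y ∈ ball x r := support_mollifierAt x hr ▸ hne
      exact hy (hρU (ball_subset_closedBall (ball_subset_ball hrρ.le hm)))
    rw [this, mul_zero]

/-- The oscillation between two Lebesgue points of an open interval is at most the variation. -/
theorem ofReal_sub_le_variation1 {u : ℝ → ℝ} {U : Set ℝ} (hU : IsOpen U) (hUc : OrdConnected U)
    (hu : LocallyIntegrableOn u U) {x y c d : ℝ} (hx : x ∈ U) (hy : y ∈ U)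
    (hxc : Tendsto (fun r : ℝ => ⨍ z in ball x r, |u z - c| ∂volume) (𝓝[>] (0 : ℝ)) (𝓝 0))
    (hyd : Tendsto (fun r : ℝ => ⨍ z in ball y r, |u z - d| ∂volume) (𝓝[>] (0 : ℝ)) (𝓝 0)) :
    ENNReal.ofReal (c - d) ≤ variation1 u U := by
  have hlim := ENNReal.tendsto_ofReal ((tendsto_integral_mul_mollifierAt hU hu hx hxc).sub
    (tendsto_integral_mul_mollifierAt hU hu hy hyd))
  refine le_of_tendsto hlim ?_
  have hpos : ∀ᶠ r : ℝ in 𝓝[>] (0 : ℝ), 0 < r := self_mem_nhdsWithin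
  have hsmall : ∀ z ∈ U, ∀ᶠ r : ℝ in 𝓝[>] (0 : ℝ), closedBall z r ⊆ U := by
    intro z hz
    obtain ⟨ρ, hρ, hρU⟩ := Metric.nhds_basis_closedBall.mem_iff.1 (hU.mem_nhds hz)
    filter_upwards [mem_nhdsWithin_of_mem_nhds (Iio_mem_nhds hρ)] with r hr
    exact (closedBall_subset_closedBall (le_of_lt hr)).trans hρU
  filter_upwards [hpos, hsmall x hx, hsmall y hy] with r hr hxr hyr
  rw [Real.closedBall_eq_Icc] at hxr hyr
  have hint : ∀ z, Icc (z - r) (z + r) ⊆ U →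
      IntegrableOn (fun w => u w * mollifierAt z r w) U := by
    intro z hz
    have h1 : IntegrableOn (fun w => u w * mollifierAt z r w) (Icc (z - r) (z + r)) :=
      (hu.integrableOn_compact_subset hz isCompact_Icc).mul_continuousOn
        (continuous_mollifierAt z hr).continuousOn isCompact_Icc
    refine (h1.integrable_of_forall_notMem_eq_zero fun w hw => ?_).integrableOn
    have : mollifierAt z r w = 0 := by
      by_contra hne
      have hm : w ∈ ball z r := support_mollifierAt z hr ▸ hne
      exact hw (Real.closedBall_eq_Icc ▸ ball_subset_closedBall hm)
    rw [this, mul_zero]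
  rw [← integral_sub (hint x hxr) (hint y hyr)]
  simp only [← mul_sub]
  have hsupp : ∀ z, min x y ≤ z → z ≤ max x y →
      Function.support (mollifierAt z r) ⊆ Icc (min x y - r) (max x y + r) := by
    intro z h1 h2
    rw [support_mollifierAt z hr, Real.ball_eq_Ioo]
    exact Ioo_subset_Icc_self.trans (Icc_subset_Icc (by linarith) (by linarith))
  have hmin : min x y - r ∈ U := by
    rcases min_choice x y with h | h <;> rw [h]
    · exact hxr ⟨le_rfl, by linarith⟩
    · exact hyr ⟨le_rfl, by linarith⟩
  have hmax : max x y + r ∈ U := by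
    rcases max_choice x y with h | h <;> rw [h]
    · exact hxr ⟨by linarith, le_rfl⟩
    · exact hyr ⟨by linarith, le_rfl⟩
  exact ofReal_integral_sub_le_variation1 (hUc.out hmin hmax)
    (continuous_mollifierAt x hr) (continuous_mollifierAt y hr)
    (mollifierAt_nonneg x hr) (mollifierAt_nonneg y hr)
    (integral_mollifierAt x hr) (integral_mollifierAt y hr)
    (hsupp x (min_le_left _ _) (le_max_left _ _)) (hsupp y (min_le_right _ _) (le_max_right _ _))

/-- If `f` has oscillation on `N ∩ I` at most `μ I` for each open interval `I ⊆ U`, then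
`f '' (N ∩ U)` has Lebesgue measure at most `μ U`. -/
theorem volume_image_inter_le {μ : Measure ℝ} {f : ℝ → ℝ} {N U : Set ℝ} (hU : IsOpen U)
    (h : ∀ I ⊆ U, IsOpen I → OrdConnected I →
      ∀ x ∈ N ∩ I, ∀ y ∈ N ∩ I, edist (f x) (f y) ≤ μ I) :
    volume (f '' (N ∩ U)) ≤ μ U := by
  let C : Set (Set ℝ) := connectedComponentIn U '' U
  have hop : ∀ I ∈ C, IsOpen I := by
    rintro _ ⟨x, -, rfl⟩
    exact hU.connectedComponentIn
  have hsub : ∀ I ∈ C, I ⊆ U := by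
    rintro _ ⟨x, -, rfl⟩
    exact connectedComponentIn_subset U x
  have hord : ∀ I ∈ C, OrdConnected I := by
    rintro _ ⟨x, -, rfl⟩
    exact isPreconnected_connectedComponentIn.ordConnected
  have hdisj : C.Pairwise Disjoint := by
    rintro _ ⟨x, -, rfl⟩ _ ⟨y, -, rfl⟩ hne
    rw [Set.disjoint_left]
    intro z hzx hzy
    exact hne ((connectedComponentIn_eq hzx).trans (connectedComponentIn_eq hzy).symm)
  have hcount : C.Countable := by
    refine Set.PairwiseDisjoint.countable_of_isOpen (s := id) hdisj hop ?_
    rintro _ ⟨x, hx, rfl⟩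
    exact ⟨x, mem_connectedComponentIn hx⟩
  have hcover : f '' (N ∩ U) ⊆ ⋃ I ∈ C, f '' (N ∩ I) := by
    rintro _ ⟨x, ⟨hxN, hxU⟩, rfl⟩
    exact mem_biUnion (mem_image_of_mem _ hxU) ⟨x, ⟨hxN, mem_connectedComponentIn hxU⟩, rfl⟩
  calc volume (f '' (N ∩ U)) ≤ volume (⋃ I ∈ C, f '' (N ∩ I)) := measure_mono hcover
    _ ≤ ∑' I : C, volume (f '' (N ∩ (I : Set ℝ))) := measure_biUnion_le _ hcount _
    _ ≤ ∑' I : C, μ (I : Set ℝ) := by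
        refine ENNReal.tsum_le_tsum fun I => (Real.volume_le_diam _).trans ?_
        refine ediam_le ?_
        rintro _ ⟨x, hx, rfl⟩ _ ⟨y, hy, rfl⟩
        exact h I (hsub I I.2) (hop I I.2) (hord I I.2) x hx y hy
    _ = μ (⋃₀ C) := (measure_sUnion hcount hdisj fun I hI => (hop I hI).measurableSet).symm
    _ ≤ μ U := measure_mono (sUnion_subset hsub)

/-- if `u ∈ BV_loc(V)` on an open set `V ⊆ ℝ`, with variation measure `μ = |Du|`,
and `N ⊆ V` consists of Lebesgue points of `u` (with Lebesgue values `ut`) with `μ N = 0`,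
then the image `ut '' N` is Lebesgue null. -/
theorem stmt5 (V : Set ℝ) (hV : IsOpen V) (u : ℝ → ℝ)
    (hloc : LocallyIntegrableOn u V)
    (μ : Measure ℝ)
    (hμ : ∀ U : Set ℝ, IsOpen U → U ⊆ V → μ U = variation1 u U)
    (hlf : ∀ K : Set ℝ, IsCompact K → K ⊆ V → μ K < ⊤)
    (N : Set ℝ) (hN : N ⊆ V) (ut : ℝ → ℝ)
    (hLeb : ∀ x ∈ N, Tendsto (fun r : ℝ => ⨍ y in ball x r, |u y - ut x| ∂volume)
      (𝓝[>] (0 : ℝ)) (𝓝 0))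
    (hμN : μ N = 0) :
    volume (ut '' N) = 0 := by
  have hosc : ∀ I ⊆ V, IsOpen I → OrdConnected I →
      ∀ x ∈ N ∩ I, ∀ y ∈ N ∩ I, edist (ut x) (ut y) ≤ μ I := by
    intro I hIV hI hIc x hx y hy
    rw [hμ I hI hIV, edist_dist, Real.dist_eq]
    have hu := hloc.mono_set hIV
    rcases abs_choice (ut x - ut y) with h | h <;> rw [h]
    · exact ofReal_sub_le_variation1 hI hIc hu hx.2 hy.2 (hLeb x hx.1) (hLeb y hy.1)
    · rw [neg_sub]
      exact ofReal_sub_le_variation1 hI hIc hu hy.2 hx.2 (hLeb y hy.1) (hLeb x hx.1)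
  have hlocal : ∀ x ∈ N, ∃ B ∈ 𝓝[N] x, volume (ut '' (N ∩ B)) = 0 := by
    intro x hx
    obtain ⟨ρ, hρ, hρV⟩ := Metric.nhds_basis_closedBall.mem_iff.1 (hV.mem_nhds (hN hx))
    have hBV : ball x ρ ⊆ V := ball_subset_closedBall.trans hρV
    refine ⟨ball x ρ, mem_nhdsWithin_of_mem_nhds (ball_mem_nhds x hρ), ?_⟩
    have hfin : IsFiniteMeasure (μ.restrict (ball x ρ)) :=
      isFiniteMeasure_restrict.2 ((measure_mono ball_subset_closedBall).trans_lt
        (hlf _ (isCompact_closedBall x ρ) hρV)).ne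
    refine le_antisymm (ENNReal.le_of_forall_pos_le_add fun ε hε _ => ?_) bot_le
    have hNB : μ.restrict (ball x ρ) N < ε :=
      ((Measure.restrict_apply_le _ _).trans_eq hμN).trans_lt (by exact_mod_cast hε)
    obtain ⟨U, hNU, hU, hUε⟩ := N.exists_isOpen_lt_of_lt (ε : ℝ≥0∞) hNB
    rw [Measure.restrict_apply hU.measurableSet] at hUε
    have hsub : U ∩ ball x ρ ⊆ V := inter_subset_right.trans hBV
    calc volume (ut '' (N ∩ ball x ρ)) ≤ volume (ut '' (N ∩ (U ∩ ball x ρ))) :=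
          measure_mono (image_mono fun y hy => ⟨hy.1, hNU hy.1, hy.2⟩)
      _ ≤ μ (U ∩ ball x ρ) := volume_image_inter_le (hU.inter isOpen_ball)
          fun I hI => hosc I (hI.trans hsub)
      _ ≤ 0 + ε := by rw [zero_add]; exact hUε.le
  choose! B hB hB0 using hlocal
  obtain ⟨t, htN, htc, hcov⟩ := TopologicalSpace.countable_cover_nhdsWithin hB
  have hsub : ut '' N ⊆ ⋃ x ∈ t, ut '' (N ∩ B x) := by
    rintro _ ⟨y, hy, rfl⟩
    obtain ⟨x, hxt, hyx⟩ := mem_iUnion₂.1 (hcov hy)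
    exact mem_biUnion hxt ⟨y, ⟨hy, hyx⟩, rfl⟩
  exact measure_mono_null hsub ((measure_biUnion_null_iff htc).2 fun x hx => hB0 x (htN hx))
end
end

section
/- Let Ω ⊂ ℝ be open and u ∈ BV_loc(Ω) with |Du|(Ω) < ∞. Then the total variation measure |Du| vanishes on the complement of H_u ∪ S_u, i.e. |Du|(Ω \ (H_u ∪ S_u)) = 0, where H_u := { x ∈ Ω : M_Ω u(x) > |u|^∨(x) } and S_u is the set of approximate discontinuity (non-Lebesgue) points of u. -/
open MeasureTheory Metric Set Filter Topology
open scoped ENNReal NNReal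
noncomputable section

/-- The one-dimensional non-centered maximal function relative to an open set `Ω`. -/
noncomputable def maxFn1On (Ω : Set ℝ) (u : ℝ → ℝ) (x : ℝ) : ℝ≥0∞ :=
  ⨆ (z : ℝ) (r : ℝ) (_ : 0 < r) (_ : x ∈ ball z r) (_ : ball z r ⊆ Ω),
    ENNReal.ofReal (⨍ y in ball z r, |u y| ∂volume)

/-- The upper approximate limit `v^∨(x)`. -/
noncomputable def upperApprox (v : ℝ → ℝ) (x : ℝ) : ℝ :=
  sInf {t : ℝ | Tendsto (fun r : ℝ => volume ({y | t < v y} ∩ ball x r) / volume (ball x r))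
    (𝓝[>] (0 : ℝ)) (𝓝 0)}

/-- The approximate discontinuity set `S_u`: the set of non-Lebesgue points. -/
def approxDiscSet (u : ℝ → ℝ) : Set ℝ :=
  {x : ℝ | ¬ ∃ c : ℝ, Tendsto (fun r : ℝ => ⨍ y in ball x r, |u y - c| ∂volume)
    (𝓝[>] (0 : ℝ)) (𝓝 0)}

/-- `c` is the Lebesgue value (approximate limit) of `u` at `x`. -/
def IsLebesgueValue (u : ℝ → ℝ) (x c : ℝ) : Prop :=
  Tendsto (fun r : ℝ => ⨍ y in ball x r, |u y - c| ∂volume) (𝓝[>] (0 : ℝ)) (𝓝 0)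

/-- A smooth step rising from `0` to `1` on `[p, p + h]`. -/
def smoothStep (p h t : ℝ) : ℝ := Real.smoothTransition ((t - p) / h)

theorem contDiff_smoothStep (p h : ℝ) : ContDiff ℝ 1 (smoothStep p h) :=
  (Real.smoothTransition.contDiff (n := 1)).comp (by fun_prop)

theorem smoothStep_nonneg (p h t : ℝ) : 0 ≤ smoothStep p h t := Real.smoothTransition.nonneg _

theorem smoothStep_le_one (p h t : ℝ) : smoothStep p h t ≤ 1 := Real.smoothTransition.le_one _

theorem smoothStep_eq_zero {p h t : ℝ} (hh : 0 < h) (ht : t ≤ p) : smoothStep p h t = 0 :=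
  Real.smoothTransition.zero_of_nonpos (div_nonpos_of_nonpos_of_nonneg (by linarith) hh.le)

theorem smoothStep_eq_one {p h t : ℝ} (hh : 0 < h) (ht : p + h ≤ t) : smoothStep p h t = 1 :=
  Real.smoothTransition.one_of_one_le (by rw [le_div_iff₀ hh]; linarith)

theorem deriv_smoothStep_eq_zero {p h t : ℝ} (hh : 0 < h) (ht : t ∉ Icc p (p + h)) :
    deriv (smoothStep p h) t = 0 := by
  rcases lt_or_ge t p with h1 | h1
  · have : smoothStep p h =ᶠ[𝓝 t] fun _ => 0 := by
      filter_upwards [Iio_mem_nhds h1] with s hs using smoothStep_eq_zero hh (le_of_lt hs)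
    rw [this.deriv_eq, deriv_const]
  · have h2 : p + h < t := by
      by_contra h3
      exact ht ⟨h1, not_lt.1 h3⟩
    have : smoothStep p h =ᶠ[𝓝 t] fun _ => 1 := by
      filter_upwards [Ioi_mem_nhds h2] with s hs using smoothStep_eq_one hh (le_of_lt hs)
    rw [this.deriv_eq, deriv_const]

theorem exists_abs_deriv_smoothStep_le :
    ∃ C : ℝ, 0 ≤ C ∧ ∀ p h t : ℝ, 0 < h → |deriv (smoothStep p h) t| ≤ C / h := by
  have hcont : Continuous (deriv Real.smoothTransition) :=
    (Real.smoothTransition.contDiff (n := 1)).continuous_deriv le_rfl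
  obtain ⟨C, hC⟩ := (isCompact_Icc (a := (0 : ℝ)) (b := 1)).exists_bound_of_continuousOn
    hcont.continuousOn
  have hC0 : 0 ≤ C := (norm_nonneg _).trans (hC 0 (by simp))
  refine ⟨C, hC0, fun p h t hh => ?_⟩
  by_cases ht : t ∈ Icc p (p + h)
  · have hd : HasDerivAt (smoothStep p h) (deriv Real.smoothTransition ((t - p) / h) * (1 / h)) t :=
      HasDerivAt.comp t
        (((Real.smoothTransition.contDiff (n := 1)).differentiable one_ne_zero) _).hasDerivAt
        (((hasDerivAt_id t).sub_const p).div_const h)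
    rw [hd.deriv, abs_mul, abs_of_pos (by positivity : 0 < 1 / h), div_eq_mul_one_div C]
    gcongr
    refine hC _ ⟨div_nonneg (by linarith [ht.1]) hh.le, ?_⟩
    rw [div_le_one hh]
    linarith [ht.2]
  · rw [deriv_smoothStep_eq_zero hh ht, abs_zero]
    positivity

theorem abs_setIntegral_sub_mul_le {u K : ℝ → ℝ} {x c h C : ℝ} {s : Set ℝ} (hh : 0 < h)
    (hs : MeasurableSet s) (hu : IntegrableOn u (ball x h))
    (hK : ∀ t, |K t| ≤ C / h) (hK0 : ∀ t ∉ ball x h, K t = 0) :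
    |∫ t in s, (u t - c) * K t| ≤ 2 * C * ⨍ y in ball x h, |u y - c| := by
  have hint : IntegrableOn (fun t => |u t - c|) (ball x h) :=
    (hu.sub (integrableOn_const measure_ball_lt_top.ne)).abs
  have hC : 0 ≤ C / h := (abs_nonneg _).trans (hK x)
  have heq : ∫ t in s ∩ ball x h, (u t - c) * K t = ∫ t in s, (u t - c) * K t :=
    (setIntegral_eq_of_subset_of_forall_sdiff_eq_zero hs inter_subset_left
      fun t ht => by rw [hK0 t fun h' => ht.2 ⟨ht.1, h'⟩, mul_zero]).symm
  calc |∫ t in s, (u t - c) * K t| ≤ ∫ t in s ∩ ball x h, |u t - c| * (C / h) := by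
        rw [← heq, ← Real.norm_eq_abs]
        refine norm_integral_le_of_norm_le ((hint.mono_set inter_subset_right).mul_const _)
          (Eventually.of_forall fun t => ?_)
        rw [norm_mul]
        exact mul_le_mul_of_nonneg_left (hK t) (norm_nonneg _)
    _ ≤ ∫ t in ball x h, |u t - c| * (C / h) :=
        setIntegral_mono_set (hint.mul_const _)
          (Eventually.of_forall fun t => mul_nonneg (abs_nonneg _) hC)
          (LE.le.eventuallyLE inter_subset_right)
    _ = 2 * C * ⨍ y in ball x h, |u y - c| := by
        rw [integral_mul_const, setAverage_eq, Measure.real, Real.volume_ball,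
          ENNReal.toReal_ofReal (by positivity), smul_eq_mul]
        field_simp

theorem setIntegral_Ioo_deriv {φ : ℝ → ℝ} (hφ : ContDiff ℝ 1 φ) {a b : ℝ} (hab : a ≤ b) :
    ∫ t in Ioo a b, deriv φ t = φ b - φ a := by
  rw [← integral_Ioc_eq_integral_Ioo, ← intervalIntegral.integral_of_le hab]
  exact intervalIntegral.integral_deriv_eq_sub
    (fun t _ => (hφ.differentiable one_ne_zero) t)
    ((hφ.continuous_deriv le_rfl).intervalIntegrable _ _)

theorem integrableOn_Ioo_mul_continuous {u K : ℝ → ℝ} {a b : ℝ} (hu : IntegrableOn u (Ioo a b))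
    (hK : Continuous K) : IntegrableOn (fun t => u t * K t) (Ioo a b) := by
  obtain ⟨C, hC⟩ := (isCompact_Icc (a := a) (b := b)).exists_bound_of_continuousOn
    hK.continuousOn
  refine Integrable.mul_bdd (c := C) hu hK.aestronglyMeasurable ?_
  filter_upwards [ae_restrict_mem measurableSet_Ioo] with t ht using hC t (Ioo_subset_Icc_self ht)

theorem setIntegral_Ioo_mul_deriv {u φ : ℝ → ℝ} {a b c : ℝ} (hab : a ≤ b)
    (hu : IntegrableOn u (Ioo a b)) (hφ : ContDiff ℝ 1 φ) :
    ∫ t in Ioo a b, u t * deriv φ t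
      = (∫ t in Ioo a b, (u t - c) * deriv φ t) + c * (φ b - φ a) := by
  have hc := hφ.continuous_deriv le_rfl
  have h1 : IntegrableOn (fun t => (u t - c) * deriv φ t) (Ioo a b) :=
    integrableOn_Ioo_mul_continuous (hu.sub (integrableOn_const (by simp))) hc
  have h2 : IntegrableOn (fun t => c * deriv φ t) (Ioo a b) :=
    integrableOn_Ioo_mul_continuous (integrableOn_const (by simp)) hc
  rw [← setIntegral_Ioo_deriv hφ hab, ← integral_const_mul, ← integral_add h1 h2]
  exact integral_congr_ae (Eventually.of_forall fun t => by simp only []; ring)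

theorem ofReal_le_variation1 {u φ : ℝ → ℝ} {U : Set ℝ} (hφ : ContDiff ℝ 1 φ)
    (hc : HasCompactSupport φ) (hsupp : tsupport φ ⊆ U) (hle : ∀ x, |φ x| ≤ 1) :
    ENNReal.ofReal (∫ x in U, u x * deriv φ x) ≤ variation1 u U :=
  le_iSup₂_of_le φ hφ <| le_iSup₂_of_le hc hsupp <| le_iSup_of_le hle le_rfl

theorem sub_le_variation1_Ioo {u : ℝ → ℝ} {x y c d : ℝ} (hxy : x < y)
    (hx : IsLebesgueValue u x c) (hy : IsLebesgueValue u y d) {δ : ℝ} (hδ : 0 < δ)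
    (hux : IntegrableOn u (Ioo (x - δ) (y + δ))) :
    ENNReal.ofReal (c - d) ≤ variation1 u (Ioo x y)
      ∧ ENNReal.ofReal (d - c) ≤ variation1 u (Ioo x y) := by
  obtain ⟨C, hC0, hC⟩ := exists_abs_deriv_smoothStep_le
  set E : ℝ → ℝ := fun h =>
    2 * (4 * C) * (⨍ t in ball x h, |u t - c|) + 2 * (4 * C) * (⨍ t in ball y h, |u t - d|) with hE
  have hElim : Tendsto E (𝓝[>] 0) (𝓝 0) := by
    simpa using (hx.const_mul (2 * (4 * C))).add (hy.const_mul (2 * (4 * C)))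
  have hev : ∀ᶠ h in 𝓝[>] (0 : ℝ), 0 < h ∧ 4 * h < y - x ∧ h < δ := by
    have h1 : ∀ᶠ h in 𝓝[>] (0 : ℝ), h < (y - x) / 4 ∧ h < δ :=
      nhdsWithin_le_nhds ((gt_mem_nhds (by linarith)).and (gt_mem_nhds hδ))
    filter_upwards [self_mem_nhdsWithin, h1] with h h0 h2
    exact ⟨h0, by linarith [h2.1], h2.2⟩
  have key : ∀ᶠ h in 𝓝[>] (0 : ℝ), ENNReal.ofReal (c - d - E h) ≤ variation1 u (Ioo x y)
      ∧ ENNReal.ofReal (d - c - E h) ≤ variation1 u (Ioo x y) := by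
    filter_upwards [hev] with h ⟨h0, h1, h2⟩
    set f := smoothStep (x + h / 4) (h / 4) with hf
    set g := smoothStep (y - h / 2) (h / 4) with hg
    have h4 : 0 < h / 4 := by positivity
    have hfd : ContDiff ℝ 1 f := contDiff_smoothStep _ _
    have hgd : ContDiff ℝ 1 g := contDiff_smoothStep _ _
    have hsub : ∀ t ∉ Icc (x + h / 4) (y - h / 4), f t - g t = 0 := by
      intro t ht
      rcases lt_or_ge t (x + h / 4) with h5 | h5
      · rw [hf, hg, smoothStep_eq_zero h4 h5.le, smoothStep_eq_zero h4 (by linarith), sub_zero]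
      · have h6 : y - h / 4 < t := by
          by_contra h7
          exact ht ⟨h5, not_lt.1 h7⟩
        rw [hf, hg, smoothStep_eq_one h4 (by linarith), smoothStep_eq_one h4 (by linarith),
          sub_self]
    have hxyδ : Ioo x y ⊆ Ioo (x - δ) (y + δ) := Ioo_subset_Ioo (by linarith) (by linarith)
    have huI := hux.mono_set hxyδ
    have hux' : IntegrableOn u (ball x h) := by
      rw [Real.ball_eq_Ioo]
      exact hux.mono_set (Ioo_subset_Ioo (by linarith) (by linarith))
    have huy' : IntegrableOn u (ball y h) := by
      rw [Real.ball_eq_Ioo]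
      exact hux.mono_set (Ioo_subset_Ioo (by linarith) (by linarith))
    have hCeq : C / (h / 4) = 4 * C / h := by field_simp
    have hIf : |∫ t in Ioo x y, (u t - c) * deriv f t|
        ≤ 2 * (4 * C) * ⨍ t in ball x h, |u t - c| := by
      refine abs_setIntegral_sub_mul_le h0 measurableSet_Ioo hux'
        (fun t => hCeq ▸ hC _ _ t h4) fun t ht => deriv_smoothStep_eq_zero h4 fun h' => ht ?_
      rw [Real.ball_eq_Ioo]
      exact ⟨by linarith [h'.1], by linarith [h'.2]⟩
    have hIg : |∫ t in Ioo x y, (u t - d) * deriv g t|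
        ≤ 2 * (4 * C) * ⨍ t in ball y h, |u t - d| := by
      refine abs_setIntegral_sub_mul_le h0 measurableSet_Ioo huy'
        (fun t => hCeq ▸ hC _ _ t h4) fun t ht => deriv_smoothStep_eq_zero h4 fun h' => ht ?_
      rw [Real.ball_eq_Ioo]
      exact ⟨by linarith [h'.1], by linarith [h'.2]⟩
    have hF := setIntegral_Ioo_mul_deriv (c := c) hxy.le huI hfd
    have hG := setIntegral_Ioo_mul_deriv (c := d) hxy.le huI hgd
    rw [show f y = 1 from smoothStep_eq_one h4 (by linarith),
      show f x = 0 from smoothStep_eq_zero h4 (by linarith)] at hF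
    rw [show g y = 1 from smoothStep_eq_one h4 (by linarith),
      show g x = 0 from smoothStep_eq_zero h4 (by linarith)] at hG
    have hdf := hfd.differentiable one_ne_zero
    have hdg := hgd.differentiable one_ne_zero
    have hint1 : IntegrableOn (fun t => u t * deriv f t) (Ioo x y) :=
      integrableOn_Ioo_mul_continuous huI (hfd.continuous_deriv le_rfl)
    have hint2 : IntegrableOn (fun t => u t * deriv g t) (Ioo x y) :=
      integrableOn_Ioo_mul_continuous huI (hgd.continuous_deriv le_rfl)
    have test : ∀ φ : ℝ → ℝ, ContDiff ℝ 1 φ → (∀ t ∉ Icc (x + h / 4) (y - h / 4), φ t = 0) →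
        (∀ t, |φ t| ≤ 1) → ∀ e, e ≤ ∫ t in Ioo x y, u t * deriv φ t →
        ENNReal.ofReal e ≤ variation1 u (Ioo x y) := by
      intro φ hφ hφ0 hφ1 e he
      refine (ENNReal.ofReal_le_ofReal he).trans (ofReal_le_variation1 hφ
        (HasCompactSupport.intro isCompact_Icc hφ0) ?_ hφ1)
      have hsub' : Icc (x + h / 4) (y - h / 4) ⊆ Ioo x y :=
        Icc_subset_Ioo (by linarith) (by linarith)
      refine Subset.trans (closure_minimal (fun t ht => ?_) isClosed_Icc) hsub'
      by_contra h'
      exact ht (hφ0 t h')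
    have hf0 := smoothStep_nonneg (x + h / 4) (h / 4)
    have hf1 := smoothStep_le_one (x + h / 4) (h / 4)
    have hg0 := smoothStep_nonneg (y - h / 2) (h / 4)
    have hg1 := smoothStep_le_one (y - h / 2) (h / 4)
    rw [abs_le] at hIf hIg
    constructor
    · refine test (fun t => f t - g t) (hfd.sub hgd) hsub
        (fun t => abs_le.2 ⟨by linarith [hf0 t, hg1 t], by linarith [hf1 t, hg0 t]⟩) _ ?_
      have : ∀ t, u t * deriv (fun t => f t - g t) t = u t * deriv f t - u t * deriv g t :=
        fun t => by rw [deriv_fun_sub (hdf t) (hdg t), mul_sub]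
      simp_rw [this]
      rw [integral_sub hint1 hint2, hF, hG]
      simp only [hE]
      linarith [hIf.1, hIg.2]
    · refine test (fun t => g t - f t) (hgd.sub hfd)
        (fun t ht => by linarith [hsub t ht])
        (fun t => abs_le.2 ⟨by linarith [hg0 t, hf1 t], by linarith [hg1 t, hf0 t]⟩) _ ?_
      have : ∀ t, u t * deriv (fun t => g t - f t) t = u t * deriv g t - u t * deriv f t :=
        fun t => by rw [deriv_fun_sub (hdg t) (hdf t), mul_sub]
      simp_rw [this]
      rw [integral_sub hint2 hint1, hF, hG]
      simp only [hE]
      linarith [hIf.2, hIg.1]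
  constructor
  · refine le_of_tendsto ?_ (key.mono fun h hh => hh.1)
    simpa using ENNReal.tendsto_ofReal ((tendsto_const_nhds (x := c - d)).sub hElim)
  · refine le_of_tendsto ?_ (key.mono fun h hh => hh.2)
    simpa using ENNReal.tendsto_ofReal ((tendsto_const_nhds (x := d - c)).sub hElim)

/-- A point with a Lebesgue value carries no variation. -/
theorem variation1_Ioo_le_sdiff_singleton {u : ℝ → ℝ} {a b x c : ℝ} (hx : x ∈ Ioo a b)
    (hc : IsLebesgueValue u x c) (hu : IntegrableOn u (Ioo a b)) :
    variation1 u (Ioo a b) ≤ variation1 u (Ioo a b \ {x}) := by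
  have hab : a ≤ b := (hx.1.trans hx.2).le
  obtain ⟨C, hC0, hC⟩ := exists_abs_deriv_smoothStep_le
  refine iSup₂_le fun φ hφ => iSup₂_le fun hφc hφU => iSup_le fun hφ1 => ?_
  have hφd := hφ.differentiable one_ne_zero
  obtain ⟨B, hB⟩ := hφc.deriv.exists_bound_of_continuous (hφ.continuous_deriv le_rfl)
  have hB0 : 0 ≤ B := (norm_nonneg _).trans (hB 0)
  set E : ℝ → ℝ := fun h => 2 * (B + 8 * C) * (⨍ t in ball x h, |u t - c|) with hE
  have hElim : Tendsto E (𝓝[>] 0) (𝓝 0) := by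
    simpa using hc.const_mul (2 * (B + 8 * C))
  have hev : ∀ᶠ h in 𝓝[>] (0 : ℝ), 0 < h ∧ h < 1 ∧ h < x - a ∧ h < b - x := by
    have h1 : ∀ᶠ h in 𝓝[>] (0 : ℝ), h < 1 ∧ h < x - a ∧ h < b - x :=
      nhdsWithin_le_nhds ((gt_mem_nhds one_pos).and
        ((gt_mem_nhds (sub_pos.2 hx.1)).and (gt_mem_nhds (sub_pos.2 hx.2))))
    filter_upwards [self_mem_nhdsWithin, h1] with h h0 h2 using ⟨h0, h2⟩
  set I := ∫ t in Ioo a b, u t * deriv φ t with hI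
  refine le_of_tendsto (x := 𝓝[>] (0 : ℝ)) (f := fun h => ENNReal.ofReal (I - E h)) ?_ ?_
  · simpa using ENNReal.tendsto_ofReal ((tendsto_const_nhds (x := I)).sub hElim)
  filter_upwards [hev] with h ⟨h0, h1, h2, h3⟩
  have h4 : 0 < h / 4 := by positivity
  set f := smoothStep (x - 3 * h / 4) (h / 4) with hf
  set g := smoothStep (x + h / 2) (h / 4) with hg
  have hfd : ContDiff ℝ 1 f := contDiff_smoothStep _ _
  have hgd : ContDiff ℝ 1 g := contDiff_smoothStep _ _
  have hdf := hfd.differentiable one_ne_zero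
  have hdg := hgd.differentiable one_ne_zero
  set η : ℝ → ℝ := fun t => f t - g t with hη
  have hηd : ContDiff ℝ 1 η := hfd.sub hgd
  have hdη := hηd.differentiable one_ne_zero
  have hη_one : ∀ t ∈ ball x (h / 2), η t = 1 := by
    intro t ht
    rw [Real.ball_eq_Ioo] at ht
    simp only [hη]
    rw [hf, hg, smoothStep_eq_one h4 (by linarith [ht.1]), smoothStep_eq_zero h4 (by linarith [ht.2]),
      sub_zero]
  have hη_zero : ∀ t ∉ Icc (x - 3 * h / 4) (x + 3 * h / 4), η t = 0 := by
    intro t ht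
    simp only [hη]
    rcases lt_or_ge t (x - 3 * h / 4) with h5 | h5
    · rw [hf, hg, smoothStep_eq_zero h4 h5.le, smoothStep_eq_zero h4 (by linarith), sub_zero]
    · have h6 : x + 3 * h / 4 < t := by
        by_contra h7
        exact ht ⟨h5, not_lt.1 h7⟩
      rw [hf, hg, smoothStep_eq_one h4 (by linarith), smoothStep_eq_one h4 (by linarith),
        sub_self]
  have hη_mem : ∀ t, 0 ≤ η t ∧ η t ≤ 1 := by
    intro t
    have hf0 : 0 ≤ f t := smoothStep_nonneg _ _ t
    have hg1 : g t ≤ 1 := smoothStep_le_one _ _ t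
    have hf1 : f t ≤ 1 := smoothStep_le_one _ _ t
    have hg0 : 0 ≤ g t := smoothStep_nonneg _ _ t
    by_cases ht : t ≤ x + h / 2
    · have : g t = 0 := smoothStep_eq_zero h4 ht
      simp only [hη, this]
      exact ⟨by linarith, by linarith⟩
    · have : f t = 1 := smoothStep_eq_one h4 (by linarith)
      simp only [hη, this]
      exact ⟨by linarith, by linarith⟩
  have hηφ : ContDiff ℝ 1 fun t => φ t * η t := hφ.mul hηd
  have hηφ' : ContDiff ℝ 1 fun t => φ t * (1 - η t) := hφ.mul (contDiff_const.sub hηd)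
  have hderiv_le : ∀ t, |deriv (fun t => φ t * η t) t| ≤ (B + 8 * C) / h := by
    intro t
    rw [deriv_fun_mul (hφd t) (hdη t)]
    have e1 : |deriv η t| ≤ 8 * C / h := by
      simp only [hη]
      rw [deriv_fun_sub (hdf t) (hdg t)]
      refine (abs_sub _ _).trans ((add_le_add (hC _ _ t h4) (hC _ _ t h4)).trans (le_of_eq ?_))
      ring
    have e2 : |deriv φ t * η t| ≤ B / h := by
      rw [abs_mul, abs_of_nonneg (hη_mem t).1, le_div_iff₀ h0]
      have := hB t
      rw [Real.norm_eq_abs] at this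
      calc |deriv φ t| * η t * h ≤ B * 1 * 1 := by
            have := (hη_mem t).1
            gcongr
            exact (hη_mem t).2
        _ = B := by ring
    have e3 : |φ t * deriv η t| ≤ 8 * C / h := by
      rw [abs_mul]
      exact (mul_le_of_le_one_left (abs_nonneg _) (hφ1 t)).trans e1
    rw [add_div]
    exact (abs_add_le _ _).trans (add_le_add e2 e3)
  have hball : ball x h ⊆ Ioo a b := by
    rw [Real.ball_eq_Ioo]
    exact Ioo_subset_Ioo (by linarith) (by linarith)
  have hsmall : |∫ t in Ioo a b, (u t - c) * deriv (fun t => φ t * η t) t| ≤ E h := by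
    refine abs_setIntegral_sub_mul_le h0 measurableSet_Ioo (hu.mono_set hball) hderiv_le
      fun t ht => ?_
    have ht' : t ∈ (Icc (x - 3 * h / 4) (x + 3 * h / 4))ᶜ := fun h' => ht (by
      rw [Real.ball_eq_Ioo]
      exact ⟨by linarith [h'.1], by linarith [h'.2]⟩)
    have : (fun t => φ t * η t) =ᶠ[𝓝 t] fun _ => 0 := by
      filter_upwards [isClosed_Icc.isOpen_compl.mem_nhds ht'] with s hs
      rw [hη_zero s hs, mul_zero]
    rw [this.deriv_eq, deriv_const]
  have hcut := setIntegral_Ioo_mul_deriv (c := c) hab hu hηφ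
  rw [hη_zero a fun h' => by linarith [h'.1], hη_zero b fun h' => by linarith [h'.2]] at hcut
  have hsplit : I = (∫ t in Ioo a b, u t * deriv (fun t => φ t * η t) t)
      + ∫ t in Ioo a b, u t * deriv (fun t => φ t * (1 - η t)) t := by
    rw [hI, ← integral_add
      (integrableOn_Ioo_mul_continuous hu (hηφ.continuous_deriv le_rfl))
      (integrableOn_Ioo_mul_continuous hu (hηφ'.continuous_deriv le_rfl))]
    refine integral_congr_ae (Eventually.of_forall fun t => ?_)
    simp only []
    rw [← mul_add, ← deriv_fun_add (hηφ.differentiable one_ne_zero t)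
      (hηφ'.differentiable one_ne_zero t)]
    congr 2
    ext s
    ring
  have hle : I - E h ≤ ∫ t in Ioo a b \ {x}, u t * deriv (fun t => φ t * (1 - η t)) t := by
    rw [setIntegral_congr_set (sdiff_null_ae_eq_self (measure_singleton x))]
    rw [abs_le] at hsmall
    linarith [hsmall.2]
  refine (ENNReal.ofReal_le_ofReal hle).trans
    (ofReal_le_variation1 hηφ' hφc.mul_right (fun t ht => ⟨?_, ?_⟩) fun t => ?_)
  · exact hφU (tsupport_mul_subset_left ht)
  · rintro rfl
    refine (notMem_tsupport_iff_eventuallyEq.2 ?_) ht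
    filter_upwards [ball_mem_nhds t (half_pos h0)] with s hs
    simp [hη_one s hs]
  · rw [abs_mul]
    exact mul_le_one₀ (hφ1 t) (abs_nonneg _)
      (abs_le.2 ⟨by linarith [(hη_mem t).2], by linarith [(hη_mem t).1]⟩)

/-- The distribution function of `ν` pushes the non-atomic part of `ν` to at most Lebesgue measure. -/
theorem measure_preimage_sdiff_atoms_le (ν : Measure ℝ) [IsFiniteMeasure ν] (N : Set ℝ) :
    ν ((fun x => ν.real (Iic x)) ⁻¹' N \ {x | 0 < ν {x}}) ≤ volume N := by
  set V : ℝ → ℝ := fun x => ν.real (Iic x) with hV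
  set D : Set ℝ := {x | 0 < ν {x}} with hD
  have hmono : Monotone V := fun x y hxy => measureReal_mono (Iic_subset_Iic.2 hxy)
  have hDc : D.Countable := Measure.countable_meas_pos_of_disjoint_iUnion
    (fun x => measurableSet_singleton x) fun x y hxy => disjoint_singleton.2 hxy
  have hIoc : ∀ p q : ℝ, ν (V ⁻¹' Ioc p q \ D) ≤ ENNReal.ofReal (q - p) := by
    intro p q
    have hm : MeasurableSet (V ⁻¹' Ioc p q \ D) :=
      (hmono.measurable measurableSet_Ioc).diff hDc.measurableSet
    rw [hm.measure_eq_iSup_isCompact ν]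
    refine iSup₂_le fun K hK => iSup_le fun hKc => ?_
    rcases K.eq_empty_or_nonempty with rfl | hne
    · simp
    obtain ⟨x, hx, hxmin⟩ := hKc.exists_isLeast hne
    obtain ⟨y, hy, hymax⟩ := hKc.exists_isGreatest hne
    have hxy : x ≤ y := hxmin hy
    have hx0 : ν {x} = 0 := by simpa [hD] using (hK hx).2
    calc ν K ≤ ν ({x} ∪ Ioc x y) := measure_mono fun z hz => by
          rcases (hxmin hz).eq_or_lt with h | h
          · exact Or.inl h.symm
          · exact Or.inr ⟨h, hymax hz⟩
      _ ≤ ν {x} + ν (Ioc x y) := measure_union_le _ _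
      _ = ENNReal.ofReal (V y - V x) := by
          rw [hx0, zero_add, hV]
          simp only []
          rw [← measureReal_sdiff (Iic_subset_Iic.2 hxy) measurableSet_Iic, Iic_sdiff_Iic,
            ofReal_measureReal]
      _ ≤ ENNReal.ofReal (q - p) := by
          have h1 : p < V x := (hK hx).1.1
          have h2 : V y ≤ q := (hK hy).1.2
          exact ENNReal.ofReal_le_ofReal (by linarith)
  have hle : OuterMeasure.map V (OuterMeasure.restrict Dᶜ ν.toOuterMeasure)
      ≤ StieltjesFunction.id.outer := by
    refine OuterMeasure.le_ofFunction.2 fun s => ?_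
    rw [StieltjesFunction.length_eq]
    refine le_iInf fun p => le_iInf fun q => le_iInf fun hs => ?_
    have hs' : s ⊆ Ioc p q := fun t ht => hs ⟨ht, fun hb => absurd (hb (t - 1)) (by simp)⟩
    rw [OuterMeasure.map_apply, OuterMeasure.restrict_apply]
    exact (measure_mono (inter_subset_inter_left _ (preimage_mono hs'))).trans (hIoc p q)
  have := hle N
  rw [OuterMeasure.map_apply, OuterMeasure.restrict_apply] at this
  rw [Real.volume_eq_stieltjes_id, StieltjesFunction.measure]
  exact this

theorem abs_setIntegral_deriv_upper_le_one {φ V : ℝ → ℝ} {a b : ℝ} (hφ : ContDiff ℝ 1 φ)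
    (hb : φ b = 0) (hφ1 : ∀ t, |φ t| ≤ 1) (hV : Monotone V) (y : ℝ) :
    |∫ t in Ioo a b ∩ {t | y ≤ V t}, deriv φ t| ≤ 1 := by
  set T := Ioo a b ∩ {t | y ≤ V t} with hT
  rcases T.eq_empty_or_nonempty with h | h
  · simp [h]
  have hbdd : BddBelow T := ⟨a, fun t ht => ht.1.1.le⟩
  obtain ⟨t₀, ht₀⟩ := h
  have hqb : sInf T ≤ b := (csInf_le hbdd ht₀).trans ht₀.1.2.le
  have hsub1 : Ioo (sInf T) b ⊆ T := by
    intro t ht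
    obtain ⟨s, hs, hst⟩ := exists_lt_of_csInf_lt ⟨t₀, ht₀⟩ ht.1
    exact ⟨⟨hs.1.1.trans hst, ht.2⟩, le_trans hs.2 (hV hst.le)⟩
  have hsub2 : T ⊆ Icc (sInf T) b := fun t ht => ⟨csInf_le hbdd ht, ht.1.2.le⟩
  have hae : T =ᵐ[volume] Ioo (sInf T) b :=
    (LE.le.eventuallyLE hsub2 |>.trans Ioo_ae_eq_Icc.symm.le).antisymm (LE.le.eventuallyLE hsub1)
  rw [setIntegral_congr_set hae, setIntegral_Ioo_deriv hφ hqb, hb, zero_sub, abs_neg]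
  exact hφ1 _

theorem variation1_Ioo_le_integral_abs_deriv {u f V : ℝ → ℝ} {a b M : ℝ} (hab : a ≤ b)
    (hV : Monotone V) (hV0 : ∀ t, 0 ≤ V t) (hVM : ∀ t, V t ≤ M) (hf : LipschitzWith 1 f)
    (hu : ∀ᵐ t ∂volume.restrict (Ioo a b), u t = f (V t)) :
    variation1 u (Ioo a b) ≤ ENNReal.ofReal (∫ y in Ioc 0 M, |deriv f y|) := by
  refine iSup₂_le fun φ hφ => iSup₂_le fun hφc hφU => iSup_le fun hφ1 =>
    ENNReal.ofReal_le_ofReal ?_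
  have hφend : ∀ t ∉ Ioo a b, φ t = 0 := fun t ht => by
    by_contra h
    exact ht (hφU (subset_tsupport φ h))
  have hφa : φ a = 0 := hφend a (by simp)
  have hφb : φ b = 0 := hφend b (by simp)
  have hc := hφ.continuous_deriv le_rfl
  obtain ⟨B, hB⟩ := hφc.deriv.exists_bound_of_continuous hc
  have hg1 : ∀ y, |deriv f y| ≤ 1 := fun y => by
    simpa using norm_deriv_le_of_lipschitz (x₀ := y) hf
  have hgm : Measurable (deriv f) := measurable_deriv f
  have hgint : IntegrableOn (deriv f) (Ioc 0 M) :=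
    Measure.integrableOn_of_bounded (M := 1) (by simp) hgm.aestronglyMeasurable
      (Eventually.of_forall hg1)
  have hfV : ∀ t, f (V t) = f 0 + ∫ y in Ioc 0 M, if y ≤ V t then deriv f y else 0 := by
    intro t
    have h1 := (hf.lipschitzOnWith (s := uIcc 0 (V t))).absolutelyContinuousOnInterval
      |>.integral_deriv_eq_sub
    rw [intervalIntegral.integral_of_le (hV0 t)] at h1
    have h2 : (fun y => if y ≤ V t then deriv f y else 0) = (Iic (V t)).indicator (deriv f) := by
      ext y; simp [indicator]
    rw [h2, setIntegral_indicator measurableSet_Iic, Ioc_inter_Iic, min_eq_right (hVM t), h1]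
    ring
  set F : ℝ → ℝ → ℝ := fun t y => (if y ≤ V t then deriv f y else 0) * deriv φ t with hF
  have hFint : Integrable (Function.uncurry F)
      ((volume.restrict (Ioo a b)).prod (volume.restrict (Ioc 0 M))) := by
    refine Integrable.of_bound (C := 1 * B) ?_ (Eventually.of_forall fun p => ?_)
    · refine Measurable.aestronglyMeasurable (Measurable.mul ?_ (hc.measurable.comp measurable_fst))
      exact Measurable.ite (measurableSet_le measurable_snd (hV.measurable.comp measurable_fst))
        (hgm.comp measurable_snd) measurable_const
    · simp only [hF, Function.uncurry, norm_mul]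
      refine mul_le_mul ?_ (hB _) (norm_nonneg _) zero_le_one
      split_ifs
      · exact hg1 _
      · simp
  have hinner : ∀ y, ‖∫ t in Ioo a b, F t y‖ ≤ |deriv f y| := by
    intro y
    have : (fun t => F t y) = {t | y ≤ V t}.indicator fun t => deriv f y * deriv φ t := by
      ext t; simp [hF, indicator]
    rw [this, setIntegral_indicator (measurableSet_le measurable_const hV.measurable),
      integral_const_mul, norm_mul]
    exact mul_le_of_le_one_right (norm_nonneg _)
      (abs_setIntegral_deriv_upper_le_one hφ hφb hφ1 hV y)
  have hswap := integral_integral_swap hFint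
  calc ∫ t in Ioo a b, u t * deriv φ t
      = ∫ t in Ioo a b, (f 0 * deriv φ t + ∫ y in Ioc 0 M, F t y) := by
        refine integral_congr_ae ?_
        filter_upwards [hu] with t ht
        rw [ht, hfV t, add_mul, ← integral_mul_const]
    _ = ∫ y in Ioc 0 M, ∫ t in Ioo a b, F t y := by
        have h1 : IntegrableOn (fun t => f 0 * deriv φ t) (Ioo a b) :=
          integrableOn_Ioo_mul_continuous (integrableOn_const (by simp)) hc
        have h2 : IntegrableOn (fun t => ∫ y in Ioc 0 M, F t y) (Ioo a b) :=
          hFint.integral_prod_left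
        rw [integral_add h1 h2, integral_const_mul, setIntegral_Ioo_deriv hφ hab, hφa, hφb, hswap]
        simp
    _ ≤ ∫ y in Ioc 0 M, |deriv f y| :=
        (le_abs_self _).trans (norm_integral_le_of_norm_le hgint.abs (Eventually.of_forall hinner))

theorem ae_deriv_ne_zero_of_volume_le_integral {f : ℝ → ℝ} {M : ℝ} (hf : LipschitzWith 1 f)
    (h : ENNReal.ofReal M ≤ ENNReal.ofReal (∫ y in Ioc 0 M, |deriv f y|)) :
    ∀ᵐ y ∂volume.restrict (Ioc 0 M), deriv f y ≠ 0 := by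
  rcases le_or_gt M 0 with hM | hM
  · simp [Ioc_eq_empty (not_lt.2 hM)]
  have hg1 : ∀ y, |deriv f y| ≤ 1 := fun y => by
    simpa using norm_deriv_le_of_lipschitz (x₀ := y) hf
  have hgint : IntegrableOn (fun y => |deriv f y|) (Ioc 0 M) :=
    (Measure.integrableOn_of_bounded (M := 1) (by simp) (measurable_deriv f).aestronglyMeasurable
      (Eventually.of_forall hg1)).abs
  have hone : IntegrableOn (fun _ : ℝ => (1 : ℝ)) (Ioc 0 M) := integrableOn_const (by simp)
  have hint : IntegrableOn (fun y => 1 - |deriv f y|) (Ioc 0 M) :=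
    hone.sub hgint
  have hle : M ≤ ∫ y in Ioc 0 M, |deriv f y| :=
    (ENNReal.ofReal_le_ofReal_iff (integral_nonneg fun y => abs_nonneg _)).1 h
  have h0 : ∫ y in Ioc 0 M, (1 - |deriv f y|) = 0 := by
    refine le_antisymm ?_ (integral_nonneg fun y => sub_nonneg.2 (hg1 y))
    rw [integral_sub hone hgint]
    simp [hM.le, hle]
  rw [integral_eq_zero_iff_of_nonneg (fun y => sub_nonneg.2 (hg1 y)) hint] at h0
  filter_upwards [h0] with y hy h'
  simp [h'] at hy

theorem upperApprox_abs_le {u : ℝ → ℝ} {x c δ : ℝ} (hδ : 0 < δ)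
    (hu : IntegrableOn u (ball x δ)) (hc : IsLebesgueValue u x c) :
    upperApprox (fun y => |u y|) x ≤ |c| := by
  refine le_of_forall_gt_imp_ge_of_dense fun t ht => csInf_le ⟨0, fun s hs => ?_⟩ ?_
  · by_contra hs0
    have huniv : {y | s < |u y|} = univ :=
      eq_univ_of_forall fun y => (not_le.1 hs0).trans_le (abs_nonneg _)
    have h1 : Tendsto (fun _ : ℝ => (1 : ℝ≥0∞)) (𝓝[>] (0 : ℝ)) (𝓝 0) := by
      refine Tendsto.congr' ?_ hs
      filter_upwards [self_mem_nhdsWithin] with r hr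
      rw [huniv, univ_inter, ENNReal.div_self (measure_ball_pos volume x hr).ne'
        measure_ball_lt_top.ne]
    exact one_ne_zero (tendsto_nhds_unique tendsto_const_nhds h1)
  · have hd : 0 < t - |c| := sub_pos.2 ht
    have hlim : Tendsto (fun r => ENNReal.ofReal ((t - |c|)⁻¹ * ⨍ y in ball x r, |u y - c|))
        (𝓝[>] 0) (𝓝 0) := by
      simpa using ENNReal.tendsto_ofReal (hc.const_mul (t - |c|)⁻¹)
    refine tendsto_of_tendsto_of_tendsto_of_le_of_le' tendsto_const_nhds hlim
      (Eventually.of_forall fun _ => zero_le) ?_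
    filter_upwards [self_mem_nhdsWithin, nhdsWithin_le_nhds (gt_mem_nhds hδ)] with r hr hrδ
    have hr0 : 0 < r := hr
    have hur : IntegrableOn (fun y => |u y - c|) (ball x r) :=
      ((hu.mono_set (ball_subset_ball hrδ.le)).sub
        (integrableOn_const measure_ball_lt_top.ne)).abs
    have hcheb := mul_meas_ge_le_integral_of_nonneg
      (Eventually.of_forall fun y => abs_nonneg (u y - c)) hur (t - |c|)
    have hsub : {y | t < |u y|} ∩ ball x r ⊆ {y | t - |c| ≤ |u y - c|} ∩ ball x r := by
      rintro y ⟨hy, hyb⟩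
      have h1 : t < |u y| := hy
      refine ⟨?_, hyb⟩
      change t - |c| ≤ |u y - c|
      linarith [abs_sub_abs_le_abs_sub (u y) c]
    have hvol : volume (ball x r) = ENNReal.ofReal (2 * r) := Real.volume_ball x r
    have hmeas : volume ({y | t < |u y|} ∩ ball x r)
        ≤ ENNReal.ofReal ((t - |c|)⁻¹ * ∫ y in ball x r, |u y - c|) := by
      refine (measure_mono hsub).trans ?_
      have : IsFiniteMeasure (volume.restrict (ball x r)) :=
        ⟨by simpa using measure_ball_lt_top (μ := volume) (x := x) (r := r)⟩
      rw [← Measure.restrict_apply' measurableSet_ball, ← ofReal_measureReal]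
      refine ENNReal.ofReal_le_ofReal ?_
      rw [inv_mul_eq_div, le_div_iff₀' hd]
      exact hcheb
    refine (ENNReal.div_le_div_right hmeas _).trans (le_of_eq ?_)
    rw [hvol, ← ENNReal.ofReal_div_of_pos (by positivity), setAverage_eq, Measure.real, hvol,
      ENNReal.toReal_ofReal (by positivity), smul_eq_mul]
    congr 1
    ring

theorem setIntegral_sub_nonpos_of_maxFn1On_le {Ω : Set ℝ} {u : ℝ → ℝ} {x k p q : ℝ}
    (hk : 0 ≤ k) (hM : maxFn1On Ω u x ≤ ENNReal.ofReal k) (hx : x ∈ Ioo p q)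
    (hΩ : Ioo p q ⊆ Ω) (hu : IntegrableOn u (Ioo p q)) :
    ∫ t in p..q, (|u t| - k) ≤ 0 := by
  have hpq : p < q := hx.1.trans hx.2
  have hb : ball ((p + q) / 2) ((q - p) / 2) = Ioo p q := by
    rw [Real.ball_eq_Ioo]
    congr 1 <;> ring
  have h1 : ENNReal.ofReal (⨍ y in Ioo p q, |u y|) ≤ ENNReal.ofReal k := by
    refine le_trans ?_ hM
    rw [← hb]
    exact le_iSup₂_of_le ((p + q) / 2) ((q - p) / 2) <|
      le_iSup₂_of_le (by linarith) (hb ▸ hx) <| le_iSup_of_le (hb ▸ hΩ) le_rfl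
  rw [ENNReal.ofReal_le_ofReal_iff hk, setAverage_eq, Measure.real, Real.volume_Ioo,
    ENNReal.toReal_ofReal (by linarith), smul_eq_mul, inv_mul_le_iff₀ (by linarith)] at h1
  rw [intervalIntegral.integral_of_le hpq.le, integral_Ioc_eq_integral_Ioo,
    integral_sub hu.abs (integrableOn_const (by simp))]
  simp only [setIntegral_const, Measure.real, Real.volume_Ioo, smul_eq_mul]
  rw [ENNReal.toReal_ofReal (by linarith)]
  linarith

theorem not_ae_pos_of_intervalIntegral_nonpos {v : ℝ → ℝ} {p q : ℝ} (hpq : p < q)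
    (hv : IntegrableOn v (Ioc p q)) (h0 : ∫ t in p..q, v t ≤ 0) :
    ¬ ∀ᵐ t ∂volume.restrict (Ioc p q), 0 < v t := by
  intro h
  rw [intervalIntegral.integral_of_le hpq.le] at h0
  have hnn : 0 ≤ᵐ[volume.restrict (Ioc p q)] v := h.mono fun t ht => ht.le
  have h1 := (integral_eq_zero_iff_of_nonneg_ae hnn hv).1 (h0.antisymm (integral_nonneg_of_ae hnn))
  have h2 : ∀ᵐ t ∂volume.restrict (Ioc p q), False := by
    filter_upwards [h, h1] with t ht ht'
    exact ht.ne' ht'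
  rw [ae_iff] at h2
  simp [hpq.not_ge] at h2

theorem not_ae_abs_gt_right {Ω : Set ℝ} {u : ℝ → ℝ} {x k p q : ℝ}
    (hk : 0 ≤ k) (hM : maxFn1On Ω u x ≤ ENNReal.ofReal k) (hx : x ∈ Ioo p q)
    (hΩ : Ioo p q ⊆ Ω) (hu : IntegrableOn u (Icc p q)) :
    ¬ ∀ᵐ t ∂volume.restrict (Ioc x q), k < |u t| := by
  have hpq : p < q := hx.1.trans hx.2
  have hv : IntegrableOn (fun t => |u t| - k) (Icc p q) :=
    hu.abs.sub (integrableOn_const (by simp))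
  have hcont : ContinuousWithinAt (fun s => ∫ t in s..q, (|u t| - k)) (uIcc p q) x :=
    intervalIntegral.continuousOn_primitive_interval_left
      (by rwa [uIcc_of_le hpq.le]) x (by rw [uIcc_of_le hpq.le]; exact Ioo_subset_Icc_self hx)
  rw [uIcc_of_le hpq.le] at hcont
  have hcont' : Tendsto (fun s => ∫ t in s..q, (|u t| - k)) (𝓝[Ioo p x] x)
      (𝓝 (∫ t in x..q, (|u t| - k))) :=
    hcont.mono_left (nhdsWithin_mono x fun s hs => ⟨hs.1.le, (hs.2.trans hx.2).le⟩)
  have : (𝓝[Ioo p x] x).NeBot := by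
    rw [← mem_closure_iff_nhdsWithin_neBot, closure_Ioo hx.1.ne]
    exact right_mem_Icc.2 hx.1.le
  have h0 : ∫ t in x..q, (|u t| - k) ≤ 0 := by
    refine le_of_tendsto hcont' ?_
    filter_upwards [self_mem_nhdsWithin] with s hs
    exact setIntegral_sub_nonpos_of_maxFn1On_le hk hM ⟨hs.2, hx.2⟩
      ((Ioo_subset_Ioo_left hs.1.le).trans hΩ)
      (hu.mono_set ((Ioo_subset_Ioo_left hs.1.le).trans Ioo_subset_Icc_self))
  intro h
  refine not_ae_pos_of_intervalIntegral_nonpos hx.2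
    (hv.mono_set fun t ht => ⟨(hx.1.trans ht.1).le, ht.2⟩) h0 ?_
  filter_upwards [h] with t ht using sub_pos.2 ht

theorem not_ae_abs_gt_left {Ω : Set ℝ} {u : ℝ → ℝ} {x k p q : ℝ}
    (hk : 0 ≤ k) (hM : maxFn1On Ω u x ≤ ENNReal.ofReal k) (hx : x ∈ Ioo p q)
    (hΩ : Ioo p q ⊆ Ω) (hu : IntegrableOn u (Icc p q)) :
    ¬ ∀ᵐ t ∂volume.restrict (Ioc p x), k < |u t| := by
  have hpq : p < q := hx.1.trans hx.2
  have hv : IntegrableOn (fun t => |u t| - k) (Icc p q) :=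
    hu.abs.sub (integrableOn_const (by simp))
  have hcont : ContinuousWithinAt (fun s => ∫ t in p..s, (|u t| - k)) (uIcc p q) x :=
    intervalIntegral.continuousOn_primitive_interval
      (by rwa [uIcc_of_le hpq.le]) x (by rw [uIcc_of_le hpq.le]; exact Ioo_subset_Icc_self hx)
  rw [uIcc_of_le hpq.le] at hcont
  have hcont' : Tendsto (fun s => ∫ t in p..s, (|u t| - k)) (𝓝[Ioo x q] x)
      (𝓝 (∫ t in p..x, (|u t| - k))) :=
    hcont.mono_left (nhdsWithin_mono x fun s hs => ⟨(hx.1.trans hs.1).le, hs.2.le⟩)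
  have : (𝓝[Ioo x q] x).NeBot := by
    rw [← mem_closure_iff_nhdsWithin_neBot, closure_Ioo hx.2.ne]
    exact left_mem_Icc.2 hx.2.le
  have h0 : ∫ t in p..x, (|u t| - k) ≤ 0 := by
    refine le_of_tendsto hcont' ?_
    filter_upwards [self_mem_nhdsWithin] with s hs
    exact setIntegral_sub_nonpos_of_maxFn1On_le hk hM ⟨hx.1, hs.1⟩
      ((Ioo_subset_Ioo_right hs.2.le).trans hΩ)
      (hu.mono_set ((Ioo_subset_Ioo_right hs.2.le).trans Ioo_subset_Icc_self))
  intro h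
  refine not_ae_pos_of_intervalIntegral_nonpos hx.1
    (hv.mono_set fun t ht => ⟨ht.1.le, (ht.2.trans_lt hx.2).le⟩) h0 ?_
  filter_upwards [h] with t ht using sub_pos.2 ht

theorem ae_isLebesgueValue {u : ℝ → ℝ} {a b : ℝ} (hu : IntegrableOn u (Ioo a b)) :
    ∀ᵐ x ∂volume.restrict (Ioo a b), IsLebesgueValue u x (u x) := by
  have hind : Integrable ((Ioo a b).indicator u) := hu.integrable_indicator measurableSet_Ioo
  have h := IsUnifLocDoublingMeasure.ae_tendsto_average_norm_sub volume hind.locallyIntegrable 1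
  filter_upwards [ae_restrict_of_ae h, ae_restrict_mem measurableSet_Ioo] with x hx hxJ
  refine Tendsto.congr' ?_ (hx (fun _ => x) (fun r : ℝ => r) tendsto_id ?_)
  · obtain ⟨δ, hδ, hball⟩ := Metric.isOpen_iff.1 isOpen_Ioo x hxJ
    filter_upwards [self_mem_nhdsWithin, nhdsWithin_le_nhds (gt_mem_nhds hδ)] with r hr hrδ
    have hcb : closedBall x r =ᵐ[volume] ball x r := by
      rw [Real.ball_eq_Ioo, Real.closedBall_eq_Icc]
      exact Ioo_ae_eq_Icc.symm
    rw [setAverage_congr hcb]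
    refine setAverage_congr_fun measurableSet_ball (Eventually.of_forall fun y hy => ?_)
    rw [indicator_of_mem (hball (ball_subset_ball hrδ.le hy)), indicator_of_mem hxJ,
      Real.norm_eq_abs]
  · filter_upwards [self_mem_nhdsWithin] with r hr
    simpa using le_of_lt hr

theorem exists_lipschitzWith_one_comp_eq {V w : ℝ → ℝ} {S : Set ℝ}
    (h : ∀ x ∈ S, ∀ y ∈ S, |w x - w y| ≤ |V x - V y|) :
    ∃ f : ℝ → ℝ, LipschitzWith 1 f ∧ ∀ x ∈ S, f (V x) = w x := by
  have hinv : ∀ y ∈ V '' S, Function.invFunOn V S y ∈ S ∧ V (Function.invFunOn V S y) = y :=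
    fun y hy => ⟨Function.invFunOn_mem hy, Function.invFunOn_eq hy⟩
  have hlip : LipschitzOnWith 1 (fun y => w (Function.invFunOn V S y)) (V '' S) := by
    refine LipschitzOnWith.of_dist_le_mul fun y hy z hz => ?_
    have := h _ (hinv y hy).1 _ (hinv z hz).1
    rw [(hinv y hy).2, (hinv z hz).2] at this
    simpa [Real.dist_eq] using this
  obtain ⟨f, hf, heq⟩ := hlip.extend_real
  refine ⟨f, hf, fun x hx => ?_⟩
  have hx' := mem_image_of_mem V hx
  rw [← heq hx']
  have := h _ (hinv _ hx').1 x hx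
  rw [(hinv _ hx').2, sub_self, abs_zero] at this
  exact sub_eq_zero.1 (abs_nonpos_iff.1 this)

theorem continuousAt_real_Iic {ν : Measure ℝ} [IsFiniteMeasure ν] {x : ℝ} (hx : ν {x} = 0) :
    ContinuousAt (fun s => ν.real (Iic s)) x := by
  have h1 : Tendsto (fun r => ν (cthickening r {x})) (𝓝 0) (𝓝 0) := by
    simpa [hx] using tendsto_measure_cthickening_of_isClosed (μ := ν) (s := {x})
      ⟨1, one_pos, measure_ne_top _ _⟩ isClosed_singleton
  have h2 : Tendsto (fun s => ν.real (cthickening |s - x| {x})) (𝓝 x) (𝓝 0) := by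
    have h3 : Tendsto (fun s => |s - x|) (𝓝 x) (𝓝 0) := by
      have : Continuous fun s : ℝ => |s - x| := by fun_prop
      simpa using this.tendsto x
    have h4 := (ENNReal.tendsto_toReal ENNReal.zero_ne_top).comp (h1.comp h3)
    rwa [ENNReal.toReal_zero] at h4
  refine tendsto_iff_norm_sub_tendsto_zero.2 (squeeze_zero (fun _ => norm_nonneg _) (fun s => ?_) h2)
  rw [cthickening_singleton _ (abs_nonneg _), Real.closedBall_eq_Icc, Real.norm_eq_abs]
  rcases le_total s x with h | h
  · rw [abs_sub_comm, ← measureReal_sdiff (Iic_subset_Iic.2 h) measurableSet_Iic, Iic_sdiff_Iic,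
      abs_of_nonneg measureReal_nonneg]
    refine measureReal_mono fun t ht => ⟨?_, ?_⟩ <;>
      linarith [ht.1, ht.2, abs_of_nonpos (sub_nonpos.2 h)]
  · rw [← measureReal_sdiff (Iic_subset_Iic.2 h) measurableSet_Iic, Iic_sdiff_Iic,
      abs_of_nonneg measureReal_nonneg]
    refine measureReal_mono fun t ht => ⟨?_, ?_⟩ <;>
      linarith [ht.1, ht.2, abs_of_nonneg (sub_nonneg.2 h)]

theorem eventually_lt_of_hasDerivAt_pos {f : ℝ → ℝ} {f' y : ℝ} (hf : HasDerivAt f f' y)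
    (h : 0 < f') : ∀ᶠ z in 𝓝 y, (y < z → f y < f z) ∧ (z < y → f z < f y) := by
  have h1 := eventually_nhdsWithin_iff.1
    ((hasDerivAt_iff_tendsto_slope.1 hf).eventually (lt_mem_nhds h))
  filter_upwards [h1] with z hz
  refine ⟨fun hyz => ?_, fun hzy => ?_⟩
  · have := hz hyz.ne'
    rw [slope_def_field, div_pos_iff_of_pos_right (sub_pos.2 hyz)] at this
    linarith
  · have := hz hzy.ne
    rw [slope_def_field, lt_div_iff_of_neg (sub_neg.2 hzy)] at this
    linarith

/-- A function whose variation is controlled by `ν` is a `1`-Lipschitz function of the distribution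
function of `ν`. -/
theorem exists_lipschitzWith_one_comp_real_Iic {u : ℝ → ℝ} {a b : ℝ} {ν : Measure ℝ}
    [IsFiniteMeasure ν] (hu : IntegrableOn u (Ioo a b))
    (hν : ∀ x ∈ Ioo a b, ∀ y ∈ Ioo a b, variation1 u (Ioo x y) ≤ ν (Ioo x y)) :
    ∃ f : ℝ → ℝ, LipschitzWith 1 f ∧
      (∀ x ∈ Ioo a b, (∃ c, IsLebesgueValue u x c) → IsLebesgueValue u x (f (ν.real (Iic x)))) ∧
      ∀ᵐ t ∂volume.restrict (Ioo a b), u t = f (ν.real (Iic t)) := by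
  classical
  let S : Set ℝ := {x | x ∈ Ioo a b ∧ ∃ c, IsLebesgueValue u x c}
  have hex : ∀ x, ∃ c, ((∃ c, IsLebesgueValue u x c) → IsLebesgueValue u x c) ∧
      (IsLebesgueValue u x (u x) → c = u x) := by
    intro x
    by_cases h : IsLebesgueValue u x (u x)
    · exact ⟨u x, fun _ => h, fun _ => rfl⟩
    · by_cases h' : ∃ c, IsLebesgueValue u x c
      · exact ⟨h'.choose, fun _ => h'.choose_spec, fun h'' => absurd h'' h⟩
      · exact ⟨0, fun h'' => absurd h'' h', fun h'' => absurd h'' h⟩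
  choose w hwL hwu using hex
  have hlt : ∀ x ∈ S, ∀ y ∈ S, x < y → |w x - w y| ≤ ν.real (Iic y) - ν.real (Iic x) := by
    intro x hx y hy hxy
    have hδ : 0 < min (x - a) (b - y) := lt_min (sub_pos.2 hx.1.1) (sub_pos.2 hy.1.2)
    have hsub : Ioo (x - min (x - a) (b - y)) (y + min (x - a) (b - y)) ⊆ Ioo a b :=
      Ioo_subset_Ioo (by linarith [min_le_left (x - a) (b - y)])
        (by linarith [min_le_right (x - a) (b - y)])
    obtain ⟨h1, h2⟩ := sub_le_variation1_Ioo hxy (hwL x hx.2) (hwL y hy.2) hδ (hu.mono_set hsub)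
    have h3 : variation1 u (Ioo x y) ≤ ENNReal.ofReal (ν.real (Iic y) - ν.real (Iic x)) := by
      rw [← measureReal_sdiff (Iic_subset_Iic.2 hxy.le) measurableSet_Iic, Iic_sdiff_Iic,
        ofReal_measureReal]
      exact (hν x hx.1 y hy.1).trans (measure_mono Ioo_subset_Ioc_self)
    have h4 : 0 ≤ ν.real (Iic y) - ν.real (Iic x) :=
      sub_nonneg.2 (measureReal_mono (Iic_subset_Iic.2 hxy.le))
    rw [abs_le']
    exact ⟨(ENNReal.ofReal_le_ofReal_iff h4).1 (h1.trans h3),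
      by linarith [(ENNReal.ofReal_le_ofReal_iff h4).1 (h2.trans h3)]⟩
  obtain ⟨f, hf, hfw⟩ := exists_lipschitzWith_one_comp_eq (V := fun x => ν.real (Iic x)) (w := w)
    (S := S) fun x hx y hy => by
      rcases lt_trichotomy x y with h | rfl | h
      · exact (hlt x hx y hy h).trans ((le_abs_self _).trans_eq (abs_sub_comm _ _))
      · simp
      · rw [abs_sub_comm]
        exact (hlt y hy x hx h).trans (le_abs_self _)
  refine ⟨f, hf, fun x hx hc => ?_, ?_⟩
  · rw [hfw x ⟨hx, hc⟩]
    exact hwL x hc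
  · filter_upwards [ae_isLebesgueValue hu, ae_restrict_mem measurableSet_Ioo] with x hx hxJ
    rw [hfw x ⟨hxJ, _, hx⟩, hwu x hx]

/-- If `u = f ∘ V` with `V` strictly increasing at `x` and `deriv f (V x) ≠ 0`, then averages of `|u|`
on suitable intervals around `x` exceed `|f (V x)|`. -/
theorem lt_maxFn1On_of_deriv_ne_zero {Ω : Set ℝ} {u f V : ℝ → ℝ} {a b x : ℝ} (hx : x ∈ Ioo a b)
    (hΩ : Ioo a b ⊆ Ω) (hu : IntegrableOn u (Ioo a b))
    (hf : ∀ᵐ t ∂volume.restrict (Ioo a b), u t = f (V t)) (hV : ContinuousAt V x)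
    (hlt : ∀ s, s < x → V s < V x) (hgt : ∀ s, x < s → V x < V s) (hd : deriv f (V x) ≠ 0) :
    ENNReal.ofReal |f (V x)| < maxFn1On Ω u x := by
  by_contra hM
  rw [not_lt] at hM
  have key : ∃ p q, x ∈ Ioo p q ∧ Icc p q ⊆ Ioo a b ∧
      ((∀ t ∈ Ioc x q, |f (V x)| < |f (V t)|) ∨ ∀ t ∈ Ioo p x, |f (V x)| < |f (V t)|) := by
    have hD := (differentiableAt_of_deriv_ne_zero hd).hasDerivAt
    have hmono : (∀ᶠ s in 𝓝 x, (x < s → f (V x) < f (V s)) ∧ (s < x → f (V s) < f (V x))) ∨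
        ∀ᶠ s in 𝓝 x, (x < s → f (V s) < f (V x)) ∧ (s < x → f (V x) < f (V s)) := by
      rcases hd.lt_or_gt with h | h
      · refine Or.inr ?_
        filter_upwards [hV.eventually (eventually_lt_of_hasDerivAt_pos hD.neg (neg_pos.2 h))]
          with s hs
        exact ⟨fun h => neg_lt_neg_iff.1 (hs.1 (hgt s h)),
          fun h => neg_lt_neg_iff.1 (hs.2 (hlt s h))⟩
      · refine Or.inl ?_
        filter_upwards [hV.eventually (eventually_lt_of_hasDerivAt_pos hD h)] with s hs
        exact ⟨fun h => hs.1 (hgt s h), fun h => hs.2 (hlt s h)⟩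
    have habs : (∀ᶠ s in 𝓝 x, x < s → |f (V x)| < |f (V s)|) ∨
        ∀ᶠ s in 𝓝 x, s < x → |f (V x)| < |f (V s)| := by
      rcases le_total 0 (f (V x)) with hc | hc
      · have hup : ∀ {r}, f (V x) < r → |f (V x)| < |r| := fun hr => by
          rw [abs_of_nonneg hc]
          exact hr.trans_le (le_abs_self _)
        exact hmono.imp (fun h => h.mono fun s hs hxs => hup (hs.1 hxs))
          fun h => h.mono fun s hs hxs => hup (hs.2 hxs)
      · have hdown : ∀ {r}, r < f (V x) → |f (V x)| < |r| := fun hr => by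
          rw [abs_of_nonpos hc]
          exact (neg_lt_neg hr).trans_le (neg_le_abs _)
        exact hmono.symm.imp (fun h => h.mono fun s hs hxs => hdown (hs.1 hxs))
          fun h => h.mono fun s hs hxs => hdown (hs.2 hxs)
    have hshrink : ∀ P : ℝ → Prop, (∀ᶠ s in 𝓝 x, P s) →
        ∃ p q, x ∈ Ioo p q ∧ Icc p q ⊆ Ioo a b ∧ ∀ t ∈ Icc p q, P t := by
      intro P hP
      obtain ⟨ε, hε, hball⟩ :=
        nhds_basis_closedBall.mem_iff.1 (inter_mem (Ioo_mem_nhds hx.1 hx.2) hP)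
      rw [Real.closedBall_eq_Icc] at hball
      exact ⟨x - ε, x + ε, ⟨by linarith, by linarith⟩, fun t ht => (hball ht).1,
        fun t ht => (hball ht).2⟩
    rcases habs with h | h
    · obtain ⟨p, q, hxpq, hpq, hP⟩ := hshrink _ h
      exact ⟨p, q, hxpq, hpq, Or.inl fun t ht => hP t ⟨(hxpq.1.trans ht.1).le, ht.2⟩ ht.1⟩
    · obtain ⟨p, q, hxpq, hpq, hP⟩ := hshrink _ h
      exact ⟨p, q, hxpq, hpq, Or.inr fun t ht => hP t ⟨ht.1.le, (ht.2.trans hxpq.2).le⟩ ht.2⟩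
  obtain ⟨p, q, hxpq, hpq, h⟩ := key
  have hf' : ∀ s ⊆ Icc p q, ∀ᵐ t ∂volume.restrict s, u t = f (V t) := fun s hs =>
    ae_restrict_of_ae_restrict_of_subset (hs.trans hpq) hf
  rcases h with h | h
  · refine not_ae_abs_gt_right (abs_nonneg _) hM hxpq
      ((Ioo_subset_Icc_self.trans hpq).trans hΩ) (hu.mono_set hpq) ?_
    filter_upwards [hf' (Ioc x q) fun t ht => ⟨(hxpq.1.trans ht.1).le, ht.2⟩,
      ae_restrict_mem measurableSet_Ioc] with t ht htm
    rw [ht]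
    exact h t htm
  · refine not_ae_abs_gt_left (abs_nonneg _) hM hxpq
      ((Ioo_subset_Icc_self.trans hpq).trans hΩ) (hu.mono_set hpq) ?_
    rw [← restrict_Ioo_eq_restrict_Ioc]
    filter_upwards [hf' (Ioo p x) fun t ht => ⟨ht.1.le, (ht.2.trans hxpq.2).le⟩,
      ae_restrict_mem measurableSet_Ioo] with t ht htm
    rw [ht]
    exact h t htm

/-- The local version of the theorem, on one interval. -/
theorem measure_inter_Ioo_eq_zero {Ω : Set ℝ} {u : ℝ → ℝ} {μ : Measure ℝ} {a b : ℝ}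
    (hab : a ≤ b) (hΩ : Ioo a b ⊆ Ω) (hu : IntegrableOn u (Ioo a b))
    (hμ : ∀ U : Set ℝ, IsOpen U → U ⊆ Ioo a b → μ U = variation1 u U) (hfin : μ (Ioo a b) < ⊤) :
    μ ((Ω \ ({x ∈ Ω | ENNReal.ofReal (upperApprox (fun y => |u y|) x) < maxFn1On Ω u x}
        ∪ approxDiscSet u)) ∩ Ioo a b) = 0 := by
  let ν := μ.restrict (Ioo a b)
  have hνfin : IsFiniteMeasure ν := ⟨by simpa [ν] using hfin⟩
  let V : ℝ → ℝ := fun x => ν.real (Iic x)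
  have hVmono : Monotone V := fun s t hst => measureReal_mono (Iic_subset_Iic.2 hst)
  obtain ⟨f, hf, hfL, hfu⟩ := exists_lipschitzWith_one_comp_real_Iic (ν := ν) hu
    fun x hx y hy => by
      have hsub : Ioo x y ⊆ Ioo a b := Ioo_subset_Ioo hx.1.le hy.2.le
      rw [← hμ _ isOpen_Ioo hsub, Measure.restrict_apply measurableSet_Ioo,
        inter_eq_self_of_subset_left hsub]
  have hd : ∀ᵐ y ∂volume.restrict (Ioc 0 (ν.real univ)), deriv f y ≠ 0 := by
    refine ae_deriv_ne_zero_of_volume_le_integral hf ?_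
    rw [ofReal_measureReal, Measure.restrict_apply_univ, hμ _ isOpen_Ioo subset_rfl]
    exact variation1_Ioo_le_integral_abs_deriv hab hVmono (fun _ => measureReal_nonneg)
      (fun _ => measureReal_mono (subset_univ _)) hf hfu
  let N : Set ℝ := {y ∈ Ioc 0 (ν.real univ) | deriv f y = 0} ∪ range (fun r : ℚ => V r) ∪ {0}
  have hN : volume N = 0 := by
    refine measure_union_null (measure_union_null ?_ ((countable_range _).measure_zero volume))
      (by simp)
    rw [ae_restrict_iff' measurableSet_Ioc, ae_iff] at hd
    refine measure_mono_null (fun y hy => ?_) hd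
    simp [hy.1.1, hy.1.2, hy.2]
  have hνJ : ∀ s ⊆ Ioo a b, ν s = μ s := fun s hs => by
    rw [Measure.restrict_apply' measurableSet_Ioo, inter_eq_self_of_subset_left hs]
  rw [← hνJ _ inter_subset_right]
  refine measure_mono_null (fun x hx => ?_)
    (le_antisymm ((measure_preimage_sdiff_atoms_le ν N).trans_eq hN) zero_le)
  obtain ⟨⟨hxΩ, hxHS⟩, hxJ⟩ := hx
  obtain ⟨hxH, hxS⟩ := not_or.1 hxHS
  have hL : IsLebesgueValue u x (f (V x)) := hfL x hxJ (not_not.1 hxS)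
  have hatom : ν {x} = 0 := by
    rw [hνJ _ (singleton_subset_iff.2 hxJ)]
    have h1 := variation1_Ioo_le_sdiff_singleton hxJ hL hu
    rw [← hμ _ isOpen_Ioo subset_rfl, ← hμ _ (isOpen_Ioo.sdiff isClosed_singleton)
      sdiff_subset] at h1
    have h2 := measure_sdiff_add_inter (μ := μ) (Ioo a b) (measurableSet_singleton x)
    rw [inter_eq_self_of_subset_right (singleton_subset_iff.2 hxJ)] at h2
    rw [← h2] at h1 hfin
    have h3 := (ENNReal.add_lt_top.1 hfin).1.ne
    exact nonpos_iff_eq_zero.1 ((ENNReal.add_le_add_iff_left h3).1 (h1.trans_eq (add_zero _).symm))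
  refine ⟨?_, fun h => (show 0 < ν {x} from h).ne' hatom⟩
  by_contra hxN
  obtain ⟨hxN', hx0⟩ := not_or.1 hxN
  obtain ⟨hxd, hxQ⟩ := not_or.1 hxN'
  have hd0 : deriv f (V x) ≠ 0 := fun h => hxd
    ⟨⟨measureReal_nonneg.lt_of_ne' hx0, measureReal_mono (subset_univ _)⟩, h⟩
  have hne : ∀ r : ℚ, V r ≠ V x := fun r hr => hxQ ⟨r, hr⟩
  have hlt : ∀ s, s < x → V s < V x := fun s hs => by
    obtain ⟨r, hsr, hrx⟩ := exists_rat_btwn hs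
    exact (hVmono hsr.le).trans_lt ((hVmono hrx.le).lt_of_ne (hne r))
  have hgt : ∀ s, x < s → V x < V s := fun s hs => by
    obtain ⟨r, hxr, hrs⟩ := exists_rat_btwn hs
    exact ((hVmono hxr.le).lt_of_ne' (hne r)).trans_le (hVmono hrs.le)
  obtain ⟨δ, hδ, hball⟩ := Metric.isOpen_iff.1 isOpen_Ioo x hxJ
  exact hxH ⟨hxΩ, (ENNReal.ofReal_le_ofReal
    (upperApprox_abs_le hδ (hu.mono_set hball) hL)).trans_lt
      (lt_maxFn1On_of_deriv_ne_zero hxJ hΩ hu hfu (continuousAt_real_Iic hatom) hlt hgt hd0)⟩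

/-- for `u ∈ BV_loc(Ω)` on an open `Ω ⊆ ℝ` with finite total variation
`|Du|(Ω) < ∞` (variation measure `μ`), the variation measure vanishes outside
`H_u ∪ S_u`, where `H_u = {M_Ω u > |u|^∨}`. -/
theorem stmt12 (Ω : Set ℝ) (hΩ : IsOpen Ω) (u : ℝ → ℝ)
    (hloc : LocallyIntegrableOn u Ω)
    (μ : Measure ℝ)
    (hμ : ∀ U : Set ℝ, IsOpen U → U ⊆ Ω → μ U = variation1 u U)
    (hfin : μ Ω < ⊤) :
    μ (Ω \ ({x ∈ Ω | ENNReal.ofReal (upperApprox (fun y => |u y|) x) < maxFn1On Ω u x}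
        ∪ approxDiscSet u)) = 0 := by
  refine measure_null_of_locally_null _ fun x hx => ?_
  obtain ⟨ε, hε, hball⟩ := nhds_basis_closedBall.mem_iff.1 (hΩ.mem_nhds hx.1)
  rw [Real.closedBall_eq_Icc] at hball
  have hsub := Ioo_subset_Icc_self.trans hball
  refine ⟨_, inter_mem_nhdsWithin _ (Ioo_mem_nhds (sub_lt_self x hε) (lt_add_of_pos_right x hε)),
    measure_inter_Ioo_eq_zero (by linarith) hsub ?_ (fun U hU hUJ => hμ U hU (hUJ.trans hsub))
      ((measure_mono hsub).trans_lt hfin)⟩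
  exact (hloc.integrableOn_compact_subset hball isCompact_Icc).mono_set Ioo_subset_Icc_self
end
end

section
/- Let Ω ⊂ ℝ be open, u ∈ BV_loc(Ω) with |Du|(Ω) < ∞, and suppose d₁ < d₂ < d₃ are points in Ω with [d₁,d₃] ⊂ Ω such that M_Ω u(d₂) = max{ M_Ω u(x) : x ∈ [d₁,d₃] }, M_Ω u(d₁) < M_Ω u(d₂), and M_Ω u(d₃) < M_Ω u(d₂). Then M_Ω u(d₂) = |u|^∨(d₂); i.e., the non-centered maximal function attains the upper approximate limit of |u| at an interior strict local maximum. -/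
open MeasureTheory Metric Set Filter Topology
open scoped ENNReal NNReal
noncomputable section

open scoped Convolution

/-- Testing the variation of `u` against a smoothed indicator of the interval between `x` and `y`
bounds the difference of two mollifications of `u`. -/
lemma mollified_sub_le_variation1 {Ω : Set ℝ} {u : ℝ → ℝ} {a b : ℝ}
    (hint : IntegrableOn u (Icc a b)) (hab : Icc a b ⊆ Ω) (hBV : variation1 u Ω < ⊤)
    (φ : ContDiffBump (0 : ℝ)) {x y : ℝ}
    (hxa : a ≤ x - φ.rOut) (hxb : x + φ.rOut ≤ b) (hya : a ≤ y - φ.rOut) (hyb : y + φ.rOut ≤ b) :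
    (φ.normed volume ⋆[ContinuousLinearMap.lsmul ℝ ℝ, volume] (Icc a b).indicator u) x
      - (φ.normed volume ⋆[ContinuousLinearMap.lsmul ℝ ℝ, volume] (Icc a b).indicator u) y
      ≤ (variation1 u Ω).toReal := by
  set ρ : ℝ → ℝ := φ.normed volume with hρ
  have hρc : Continuous ρ := φ.continuous_normed
  have hρ0 : ∀ s, 0 ≤ ρ s := fun s => φ.nonneg_normed s
  have hρi : Integrable ρ := φ.integrable_normed
  have hρs : ∀ s, φ.rOut ≤ |s| → ρ s = 0 := by
    intro s hs
    by_contra h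
    have : s ∈ Function.support ρ := h
    rw [hρ, φ.support_normed_eq, mem_ball_zero_iff, Real.norm_eq_abs] at this
    linarith
  set Φ : ℝ → ℝ := fun z => ∫ s in (z - y)..(z - x), ρ s with hΦ
  have hderiv : ∀ z, HasDerivAt Φ (ρ (z - x) - ρ (z - y)) z := by
    intro z
    have hF : ∀ w, HasDerivAt (fun v => ∫ s in (0 : ℝ)..v, ρ s) (ρ w) w := fun w =>
      (hρc.integral_hasStrictDerivAt 0 w).hasDerivAt
    have h := ((hF (z - x)).comp z ((hasDerivAt_id z).sub_const x)).sub
      ((hF (z - y)).comp z ((hasDerivAt_id z).sub_const y))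
    simp only [mul_one] at h
    refine h.congr_of_eventuallyEq (Eventually.of_forall fun w => ?_)
    exact (intervalIntegral.integral_interval_sub_left (hρc.intervalIntegrable _ _)
      (hρc.intervalIntegrable _ _)).symm
  have hderiv' : deriv Φ = fun z => ρ (z - x) - ρ (z - y) := funext fun z => (hderiv z).deriv
  have hC1 : ContDiff ℝ 1 Φ := by
    rw [contDiff_one_iff_deriv, hderiv']
    exact ⟨fun z => (hderiv z).differentiableAt, by fun_prop⟩
  have hzero : ∀ z, z ∉ Icc a b → Φ z = 0 := by
    intro z hz
    refine intervalIntegral.integral_zero_ae (Eventually.of_forall fun s hs => hρs s ?_)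
    rw [mem_uIoc] at hs
    by_cases hza : a ≤ z
    · have hzb : b < z := by
        by_contra h
        exact hz ⟨hza, not_lt.1 h⟩
      refine le_trans ?_ (le_abs_self s)
      rcases hs with hs | hs <;> linarith [hs.1]
    · refine le_trans ?_ (neg_le_abs s)
      push Not at hza
      rcases hs with hs | hs <;> linarith [hs.2]
  have hsupp : tsupport Φ ⊆ Icc a b :=
    closure_minimal (fun z hz => by_contra fun h => hz (hzero z h)) isClosed_Icc
  have habs : ∀ z, |Φ z| ≤ 1 := by
    intro z
    calc ‖Φ z‖ ≤ ∫ s in uIoc (z - y) (z - x), ‖ρ s‖ :=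
          intervalIntegral.norm_integral_le_integral_norm_uIoc
      _ ≤ ∫ s, ‖ρ s‖ := setIntegral_le_integral hρi.norm
          (Eventually.of_forall fun _ => norm_nonneg _)
      _ = ∫ s, ρ s := by simp_rw [Real.norm_of_nonneg (hρ0 _)]
      _ = 1 := φ.integral_normed
  have hle : ENNReal.ofReal (∫ z in Ω, u z * deriv Φ z) ≤ variation1 u Ω := by
    unfold variation1
    exact le_iSup_of_le Φ (le_iSup_of_le hC1 (le_iSup_of_le
      (isCompact_Icc.of_isClosed_subset (isClosed_tsupport _) hsupp)
      (le_iSup_of_le (hsupp.trans hab) (le_iSup_of_le habs le_rfl))))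
  have hle' := (ENNReal.ofReal_le_iff_le_toReal hBV.ne).1 hle
  have hUi : Integrable ((Icc a b).indicator u) := hint.integrable_indicator measurableSet_Icc
  have hmul : ∀ w, Integrable fun z => ρ (w - z) * (Icc a b).indicator u z := by
    intro w
    obtain ⟨C, hC⟩ := (φ.hasCompactSupport_normed (μ := volume)).exists_bound_of_continuous hρc
    exact hUi.bdd_mul (c := C) (by fun_prop) (Eventually.of_forall fun z => hC _)
  have hsym : ∀ w z, ρ (w - z) = ρ (z - w) := by
    intro w z
    rw [← neg_sub, hρ, φ.normed_neg]
  have hdz : ∀ z, z ∉ Icc a b → ρ (z - x) - ρ (z - y) = 0 := by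
    intro z hz
    have : ∀ w, a ≤ w - φ.rOut → w + φ.rOut ≤ b → ρ (z - w) = 0 := by
      intro w h1 h2
      refine hρs _ ?_
      by_contra h
      rw [not_le, abs_lt] at h
      exact hz ⟨by linarith, by linarith⟩
    rw [this x hxa hxb, this y hya hyb, sub_zero]
  rw [convolution_lsmul_swap, convolution_lsmul_swap]
  simp only [smul_eq_mul]
  rw [← integral_sub (hmul x) (hmul y)]
  refine le_trans (le_of_eq ?_) hle'
  rw [hderiv', setIntegral_eq_integral_of_forall_compl_eq_zero]
  · refine integral_congr_ae (Eventually.of_forall fun z => ?_)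
    by_cases hz : z ∈ Icc a b
    · simp only [indicator_of_mem hz, hsym x, hsym y]
      ring
    · simp only [indicator_of_notMem hz, hdz z hz, mul_zero, sub_zero]
  · intro z hz
    simp only [hdz z fun h => hz (hab h), mul_zero]

/-- A function of finite variation is essentially bounded on bounded intervals. -/
lemma exists_ae_abs_le_of_variation1_lt_top {Ω : Set ℝ} {u : ℝ → ℝ} {a b : ℝ}
    (hint : IntegrableOn u (Icc a b)) (hlt : a < b) (hab : Icc a b ⊆ Ω)
    (hBV : variation1 u Ω < ⊤) :
    ∃ C : ℝ, ∀ᵐ x, x ∈ Ioo a b → |u x| ≤ C := by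
  let φ : ℕ → ContDiffBump (0 : ℝ) := fun n =>
    ⟨1 / ((n : ℝ) + 1), 2 * (1 / ((n : ℝ) + 1)), by positivity, by
      have : (0 : ℝ) < 1 / ((n : ℝ) + 1) := by positivity
      linarith⟩
  have hφ : Tendsto (fun n => (φ n).rOut) atTop (𝓝 0) := by
    simpa only [mul_zero] using
      (tendsto_one_div_add_atTop_nhds_zero_nat (𝕜 := ℝ)).const_mul (2 : ℝ)
  have hUi : Integrable ((Icc a b).indicator u) := hint.integrable_indicator measurableSet_Icc
  have hae := ContDiffBump.ae_convolution_tendsto_right_of_locallyIntegrable (K := 2) hφ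
    (Eventually.of_forall fun n => le_rfl) hUi.locallyIntegrable
  have key : ∀ x ∈ Ioo a b, ∀ y ∈ Ioo a b,
      Tendsto (fun n => ((φ n).normed volume ⋆[ContinuousLinearMap.lsmul ℝ ℝ, volume]
        (Icc a b).indicator u) x) atTop (𝓝 ((Icc a b).indicator u x)) →
      Tendsto (fun n => ((φ n).normed volume ⋆[ContinuousLinearMap.lsmul ℝ ℝ, volume]
        (Icc a b).indicator u) y) atTop (𝓝 ((Icc a b).indicator u y)) →
      u x - u y ≤ (variation1 u Ω).toReal := by
    intro x hx y hy htx hty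
    have h := htx.sub hty
    rw [indicator_of_mem (Ioo_subset_Icc_self hx), indicator_of_mem (Ioo_subset_Icc_self hy)] at h
    refine le_of_tendsto h ?_
    filter_upwards [hφ.eventually_lt_const (sub_pos.2 hx.1), hφ.eventually_lt_const (sub_pos.2 hx.2),
      hφ.eventually_lt_const (sub_pos.2 hy.1), hφ.eventually_lt_const (sub_pos.2 hy.2)]
      with n h1 h2 h3 h4
    exact mollified_sub_le_variation1 hint hab hBV (φ n) (by linarith) (by linarith)
      (by linarith) (by linarith)
  obtain ⟨y, hy, hty⟩ : ∃ y ∈ Ioo a b,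
      Tendsto (fun n => ((φ n).normed volume ⋆[ContinuousLinearMap.lsmul ℝ ℝ, volume]
        (Icc a b).indicator u) y) atTop (𝓝 ((Icc a b).indicator u y)) := by
    have hne : volume (Ioo a b) ≠ 0 := (isOpen_Ioo.measure_pos volume (nonempty_Ioo.2 hlt)).ne'
    exact Measure.exists_mem_of_measure_ne_zero_of_ae hne (ae_restrict_of_ae hae)
  refine ⟨|u y| + (variation1 u Ω).toReal, ?_⟩
  filter_upwards [hae] with x htx hx
  have h1 := key x hx y hy htx hty
  have h2 := key y hy x hx hty htx
  rw [abs_le]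
  constructor <;> linarith [le_abs_self (u y), neg_abs_le (u y)]

/-- Lebesgue differentiation bounds `|u|` by its maximal function. -/
lemma ae_abs_le_maxFn1On {Ω : Set ℝ} {u : ℝ → ℝ} {a b : ℝ}
    (hint : IntegrableOn u (Icc a b)) (hab : Icc a b ⊆ Ω) :
    ∀ᵐ x, x ∈ Ioo a b → ENNReal.ofReal |u x| ≤ maxFn1On Ω u x := by
  have hUi : Integrable ((Icc a b).indicator fun y => |u y|) :=
    IntegrableOn.integrable_indicator hint.abs measurableSet_Icc
  filter_upwards [IsUnifLocDoublingMeasure.ae_tendsto_average (μ := volume)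
    hUi.locallyIntegrable 1] with x hx hxI
  have h := hx (fun _ : ℝ => x) (fun r : ℝ => r) (l := 𝓝[>] 0) tendsto_id
    (by
      filter_upwards [self_mem_nhdsWithin] with r hr
      exact mem_closedBall_self (by simpa using le_of_lt hr))
  rw [indicator_of_mem (Ioo_subset_Icc_self hxI)] at h
  refine le_of_tendsto (ENNReal.tendsto_ofReal h) ?_
  have hr1 : ∀ᶠ r : ℝ in 𝓝[>] 0, r < x - a :=
    nhdsWithin_le_nhds (eventually_lt_nhds (sub_pos.2 hxI.1))
  have hr2 : ∀ᶠ r : ℝ in 𝓝[>] 0, r < b - x :=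
    nhdsWithin_le_nhds (eventually_lt_nhds (sub_pos.2 hxI.2))
  filter_upwards [self_mem_nhdsWithin, hr1, hr2] with r hr h1 h2
  have hr : 0 < r := hr
  have hsub : ball x r ⊆ Icc a b := by
    rw [Real.ball_eq_Ioo]
    exact Ioo_subset_Icc_self.trans (Icc_subset_Icc (by linarith) (by linarith))
  have hball : closedBall x r =ᵐ[volume] ball x r := by
    rw [Real.ball_eq_Ioo, Real.closedBall_eq_Icc]
    exact Ioo_ae_eq_Icc.symm
  have heq : ⨍ y in closedBall x r, (Icc a b).indicator (fun y => |u y|) y =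
      ⨍ y in ball x r, |u y| := by
    rw [setAverage_congr hball]
    refine setAverage_congr_fun measurableSet_ball (Eventually.of_forall fun y hy => ?_)
    exact indicator_of_mem (hsub hy) _
  rw [heq]
  unfold maxFn1On
  exact le_iSup_of_le x (le_iSup_of_le r (le_iSup_of_le hr (le_iSup_of_le (mem_ball_self hr)
    (le_iSup_of_le (hsub.trans hab) le_rfl))))

/-- Averages of a function bounded by `m` are bounded by `m`, with a gain controlled by the measure
of the set where the function is at most `t`. -/
lemma setAverage_ball_le_sub {v : ℝ → ℝ} {z r m t p : ℝ} (hr : 0 < r)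
    (hint : IntegrableOn v (ball z r)) (hle : ∀ᵐ y ∂volume.restrict (ball z r), v y ≤ m)
    (htm : t ≤ m) (hp : p ≤ volume.real ({y | v y ≤ t} ∩ ball z r)) :
    ⨍ y in ball z r, v y ≤ m - (m - t) * p / (2 * r) := by
  have hfin : volume (ball z r) ≠ ⊤ := measure_ball_lt_top.ne
  have hc : IntegrableOn (fun _ => m) (ball z r) := integrableOn_const hfin
  have h := mul_meas_ge_le_integral_of_nonneg (μ := volume.restrict (ball z r))
    (f := fun y => m - v y) (hle.mono fun y hy => sub_nonneg.2 hy) (hc.sub hint) (m - t)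
  have hset : {y | m - t ≤ m - v y} = {y | v y ≤ t} := by
    ext y
    exact sub_le_sub_iff_left m
  rw [hset, measureReal_restrict_apply' measurableSet_ball, integral_sub hc hint,
    setIntegral_const, Real.volume_real_ball hr.le, smul_eq_mul] at h
  rw [setAverage_eq, Real.volume_real_ball hr.le, smul_eq_mul, inv_mul_le_iff₀ (by positivity)]
  have h2 : 2 * r * (m - (m - t) * p / (2 * r)) = 2 * r * m - (m - t) * p := by
    field_simp
  rw [h2]
  nlinarith [mul_le_mul_of_nonneg_left hp (sub_nonneg.2 htm)]

/-- If `{v > t}` fills at most a quarter of each small ball around `x`, then `{v ≤ t}` has measure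
comparable to `min δ r` in each ball of radius `r` containing `x`. -/
lemma min_div_two_le_volume_inter_ball {v : ℝ → ℝ} {t x z r δ : ℝ} (hr : 0 < r) (hδ : 0 < δ)
    (hx : x ∈ ball z r)
    (hdens : ∀ s, 0 < s → s ≤ δ → volume.real ({y | t < v y} ∩ ball x s) ≤ s / 2) :
    min δ r / 2 ≤ volume.real ({y | v y ≤ t} ∩ ball z r) := by
  set s := min δ r with hs
  have hs0 : 0 < s := lt_min hδ hr
  have hsr : s ≤ r := min_le_right _ _
  rw [Real.ball_eq_Ioo] at hx
  obtain ⟨c, hcx, hcz⟩ : ∃ c, Ioo c (c + s) ⊆ ball x s ∧ Ioo c (c + s) ⊆ ball z r := by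
    simp only [Real.ball_eq_Ioo]
    rcases le_total x z with h | h
    · exact ⟨x, Ioo_subset_Ioo (by linarith) le_rfl, Ioo_subset_Ioo hx.1.le (by linarith)⟩
    · exact ⟨x - s, Ioo_subset_Ioo le_rfl (by linarith),
        Ioo_subset_Ioo (by linarith) (by linarith [hx.2])⟩
  have hcov : Ioo c (c + s) ⊆ ({y | v y ≤ t} ∩ ball z r) ∪ ({y | t < v y} ∩ ball x s) := by
    intro y hy
    rcases le_or_gt (v y) t with h | h
    · exact Or.inl ⟨h, hcz hy⟩
    · exact Or.inr ⟨h, hcx hy⟩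
  have hf1 : volume ({y | v y ≤ t} ∩ ball z r) ≠ ⊤ :=
    measure_ne_top_of_subset inter_subset_right measure_ball_lt_top.ne
  have hf2 : volume ({y | t < v y} ∩ ball x s) ≠ ⊤ :=
    measure_ne_top_of_subset inter_subset_right measure_ball_lt_top.ne
  have h1 := (measureReal_mono hcov (measure_union_ne_top hf1 hf2)).trans (measureReal_union_le _ _)
  rw [Real.volume_real_Ioo_of_le (by linarith)] at h1
  linarith [hdens s hs0 (min_le_left _ _)]

/-- If `{v > t}` has density zero at `x`, it fills at most a quarter of each small ball. -/
lemma exists_volume_inter_ball_le_of_tendsto {v : ℝ → ℝ} {t x : ℝ}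
    (h : Tendsto (fun r : ℝ => volume ({y | t < v y} ∩ ball x r) / volume (ball x r))
      (𝓝[>] (0 : ℝ)) (𝓝 0)) :
    ∃ δ > 0, ∀ s, 0 < s → s ≤ δ → volume.real ({y | t < v y} ∩ ball x s) ≤ s / 2 := by
  have h4 := h.eventually_lt_const (show (0 : ℝ≥0∞) < ENNReal.ofReal (1 / 4) by simp)
  obtain ⟨δ, hδ, hsub⟩ := mem_nhdsGT_iff_exists_Ioc_subset.1 h4
  refine ⟨δ, hδ, fun s hs0 hs => ?_⟩
  have hlt : volume ({y | t < v y} ∩ ball x s) / volume (ball x s) < ENNReal.ofReal (1 / 4) :=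
    hsub ⟨hs0, hs⟩
  have hle := (ENNReal.div_le_iff (measure_ball_pos volume x hs0).ne' measure_ball_lt_top.ne).1 hlt.le
  rw [Real.volume_ball, ← ENNReal.ofReal_mul (by norm_num)] at hle
  refine (ENNReal.toReal_le_of_le_ofReal (by positivity) hle).trans (le_of_eq (by ring))

/-- Under an upper bound for averages over balls around `x` inside `[a, b]`, the maximal function
at an interior point of `[a, b]` is controlled by that bound and its values at `a` and `b`. -/
lemma maxFn1On_le_max {Ω : Set ℝ} {u : ℝ → ℝ} {a b x c : ℝ} (hx : x ∈ Ioo a b)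
    (hc : ∀ z r, 0 < r → x ∈ ball z r → ball z r ⊆ Ioo a b → ⨍ y in ball z r, |u y| ≤ c) :
    maxFn1On Ω u x ≤ max (ENNReal.ofReal c) (max (maxFn1On Ω u a) (maxFn1On Ω u b)) := by
  have hself : ∀ w z r : ℝ, 0 < r → w ∈ ball z r → ball z r ⊆ Ω →
      ENNReal.ofReal (⨍ y in ball z r, |u y|) ≤ maxFn1On Ω u w := fun w z r hr hw hΩ =>
    le_iSup_of_le z (le_iSup_of_le r (le_iSup_of_le hr (le_iSup_of_le hw
      (le_iSup_of_le hΩ le_rfl))))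
  conv_lhs => unfold maxFn1On
  refine iSup_le fun z => iSup_le fun r => iSup_le fun hr => iSup_le fun hxr => iSup_le fun hΩ => ?_
  by_cases ha : a ∈ ball z r
  · exact (hself a z r hr ha hΩ).trans ((le_max_left _ _).trans (le_max_right _ _))
  by_cases hb : b ∈ ball z r
  · exact (hself b z r hr hb hΩ).trans ((le_max_right _ _).trans (le_max_right _ _))
  refine (ENNReal.ofReal_le_ofReal (hc z r hr hxr fun y hy => ?_)).trans (le_max_left _ _)
  have hconv : (ball z r).OrdConnected := (convex_ball z r).ordConnected
  constructor
  · by_contra h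
    exact ha (hconv.out hy hxr ⟨not_lt.1 h, hx.1.le⟩)
  · by_contra h
    exact hb (hconv.out hxr hy ⟨hx.2.le, not_lt.1 h⟩)

/-- if `u ∈ BV_loc(Ω)` with `|Du|(Ω) < ∞` and `M_Ω u` has an interior
strict local maximum at `d₂ ∈ (d₁, d₃)` over `[d₁, d₃] ⊆ Ω`, then
`M_Ω u (d₂) = |u|^∨(d₂)`. -/
theorem stmt13 (Ω : Set ℝ) (hΩ : IsOpen Ω) (u : ℝ → ℝ)
    (hloc : LocallyIntegrableOn u Ω)
    (hBV : variation1 u Ω < ⊤)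
    (d₁ d₂ d₃ : ℝ) (h12 : d₁ < d₂) (h23 : d₂ < d₃) (hsub : Set.Icc d₁ d₃ ⊆ Ω)
    (hmax : ∀ x ∈ Set.Icc d₁ d₃, maxFn1On Ω u x ≤ maxFn1On Ω u d₂)
    (h1 : maxFn1On Ω u d₁ < maxFn1On Ω u d₂)
    (h3 : maxFn1On Ω u d₃ < maxFn1On Ω u d₂) :
    maxFn1On Ω u d₂ = ENNReal.ofReal (upperApprox (fun y => |u y|) d₂) := by
  have hint : IntegrableOn u (Icc d₁ d₃) := hloc.integrableOn_compact_subset hsub isCompact_Icc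
  have hd₂ : d₂ ∈ Ioo d₁ d₃ := ⟨h12, h23⟩
  have hends : max (maxFn1On Ω u d₁) (maxFn1On Ω u d₃) < maxFn1On Ω u d₂ := max_lt h1 h3
  have hintB : ∀ z r, ball z r ⊆ Ioo d₁ d₃ → IntegrableOn (fun y => |u y|) (ball z r) :=
    fun z r h => (hint.mono_set (h.trans Ioo_subset_Icc_self)).abs
  have haeB : ∀ {C : ℝ}, (∀ᵐ y, y ∈ Ioo d₁ d₃ → |u y| ≤ C) → ∀ z r, ball z r ⊆ Ioo d₁ d₃ →
      ∀ᵐ y ∂volume.restrict (ball z r), |u y| ≤ C := fun hC z r h =>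
    (ae_restrict_iff' measurableSet_ball).2 (hC.mono fun y hy hyB => hy (h hyB))
  have hfin : maxFn1On Ω u d₂ < ⊤ := by
    obtain ⟨C, hC⟩ := exists_ae_abs_le_of_variation1_lt_top hint (h12.trans h23) hsub hBV
    refine (maxFn1On_le_max (c := C) hd₂ fun z r hr hxr hB => ?_).trans_lt
      (max_lt ENNReal.ofReal_lt_top (hends.trans_le le_top))
    simpa using setAverage_ball_le_sub (p := 0) hr (hintB z r hB) (haeB hC z r hB) le_rfl
      measureReal_nonneg
  set m : ℝ := (maxFn1On Ω u d₂).toReal with hm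
  have hofm : ENNReal.ofReal m = maxFn1On Ω u d₂ := ENNReal.ofReal_toReal hfin.ne
  have hm0 : 0 < m := ENNReal.toReal_pos (bot_lt_iff_ne_bot.1 (bot_le.trans_lt h1)) hfin.ne
  have hum : ∀ᵐ y, y ∈ Ioo d₁ d₃ → |u y| ≤ m := by
    filter_upwards [ae_abs_le_maxFn1On hint hsub] with y hy hyI
    exact (ENNReal.ofReal_le_iff_le_toReal hfin.ne).1
      ((hy hyI).trans (hmax y (Ioo_subset_Icc_self hyI)))
  have hmem : m ∈ {t : ℝ | Tendsto (fun r : ℝ => volume ({y | t < |u y|} ∩ ball d₂ r) /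
      volume (ball d₂ r)) (𝓝[>] (0 : ℝ)) (𝓝 0)} := by
    refine tendsto_const_nhds.congr' ?_
    obtain ⟨ε, hε, hball⟩ := Metric.isOpen_iff.1 isOpen_Ioo d₂ hd₂
    filter_upwards [Ioo_mem_nhdsGT hε] with r hr
    have hz : volume ({y | m < |u y|} ∩ ball d₂ r) = 0 := by
      refine measure_mono_null (fun y hy => ?_) (ae_iff.1 hum)
      exact fun h => not_le.2 hy.1 (h (hball (ball_subset_ball hr.2.le hy.2)))
    rw [hz, ENNReal.zero_div]
  have hlb : ∀ t ∈ {t : ℝ | Tendsto (fun r : ℝ => volume ({y | t < |u y|} ∩ ball d₂ r) /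
      volume (ball d₂ r)) (𝓝[>] (0 : ℝ)) (𝓝 0)}, m ≤ t := by
    intro t ht
    by_contra! htm
    obtain ⟨δ, hδ, hdens⟩ := exists_volume_inter_ball_le_of_tendsto ht
    set κ : ℝ := min (δ / (d₃ - d₁)) 1 with hκ
    have hL : 0 < d₃ - d₁ := by linarith
    have hκ0 : 0 < κ := lt_min (div_pos hδ hL) one_pos
    have hgain : 0 < (m - t) * κ / 4 := by
      have := sub_pos.2 htm
      positivity
    have hle := maxFn1On_le_max (Ω := Ω) (u := u) (c := m - (m - t) * κ / 4) hd₂ ?_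
    · refine absurd hle (not_le.2 (max_lt ?_ hends))
      rw [← hofm]
      exact (ENNReal.ofReal_lt_ofReal_iff hm0).2 (by linarith)
    · intro z r hr hxr hB
      have hrL : r ≤ d₃ - d₁ := by
        rw [Real.ball_eq_Ioo, Ioo_subset_Ioo_iff (by linarith)] at hB
        linarith
      have hκr : κ * r ≤ min δ r := by
        refine le_min ?_ (mul_le_of_le_one_left hr.le (min_le_right _ _))
        calc κ * r ≤ δ / (d₃ - d₁) * (d₃ - d₁) :=
              mul_le_mul (min_le_left _ _) hrL hr.le (div_pos hδ hL).le
          _ = δ := div_mul_cancel₀ _ hL.ne'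
      have hp := min_div_two_le_volume_inter_ball hr hδ hxr hdens
      refine (setAverage_ball_le_sub (p := κ * r / 2) hr (hintB z r hB) (haeB hum z r hB) htm.le
        (le_trans (by linarith) hp)).trans (le_of_eq ?_)
      field_simp
      ring
  have hup : upperApprox (fun y => |u y|) d₂ = m :=
    le_antisymm (csInf_le ⟨m, hlb⟩ hmem) (le_csInf ⟨m, hmem⟩ hlb)
  rw [hup, hofm]
end
end

section
/- Let E ⊂ ℝ² be the perturbed annulus E := (E₀ \ B(c, δ²)) ∪ (B(c, δ²) \ B(0,1)) with E₀ := B(0,1) \ B(0, 1−δ), δ = 0.01, c = (0,1). Then for every x ∈ B(0, δ), the unique ball realizing the non-centered maximal function of 𝟙_E at x is B(0,1); consequently M𝟙_E is constant on B(0,δ) (so ∇M𝟙_E = 0 there), while D₂𝟙_E(B(0,1)) < 0 and D₂𝟙_E(closure(B(0,1))) > 0. -/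
open MeasureTheory Metric Set Filter Topology
open scoped ENNReal NNReal
noncomputable section

/-- The non-centered maximal function of the characteristic function of `E`,
written via volume ratios. -/
noncomputable def maxFnInd {d : ℕ} (E : Set (EuclideanSpace ℝ (Fin d)))
    (x : EuclideanSpace ℝ (Fin d)) : ℝ≥0∞ :=
  ⨆ (z : EuclideanSpace ℝ (Fin d)) (r : ℝ) (_ : 0 < r) (_ : x ∈ ball z r),
    volume (E ∩ ball z r) / volume (ball z r)

section SectorArea

/-- The area, in the complex plane, of a circular sector symmetric about the positive real axis. -/
lemma volume_complex_sector {a b α : ℝ} (ha : 0 < a) (hab : a ≤ b) (hα : 0 ≤ α) (hαπ : α ≤ Real.pi) :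
    volume {w : ℂ | a ≤ ‖w‖ ∧ ‖w‖ < b ∧ Real.cos α * ‖w‖ < w.re} =
      ENNReal.ofReal (α * (b ^ 2 - a ^ 2)) := by
  set T : Set ℂ := {w : ℂ | a ≤ ‖w‖ ∧ ‖w‖ < b ∧ Real.cos α * ‖w‖ < w.re} with hT
  have hTm : MeasurableSet T := by
    refine (measurableSet_le measurable_const measurable_norm).inter
      ((measurableSet_lt measurable_norm measurable_const).inter
        (measurableSet_lt (measurable_norm.const_mul _) Complex.measurable_re))
  have key : ∀ p ∈ polarCoord.target,
      ENNReal.ofReal p.1 • T.indicator (fun _ => (1 : ℝ≥0∞)) (Complex.polarCoord.symm p) =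
        (Ico a b).indicator (fun s => ENNReal.ofReal s) p.1 *
          (Ioo (-α) α).indicator (fun _ => (1 : ℝ≥0∞)) p.2 := by
    rintro ⟨s, θ⟩ hp
    simp only [polarCoord_target, mem_prod, mem_Ioi, mem_Ioo] at hp
    obtain ⟨hs, hθ1, hθ2⟩ := hp
    have hre : (Complex.polarCoord.symm (s, θ)).re = s * Real.cos θ := by
      rw [Complex.polarCoord_symm_apply]; simp [Complex.cos_ofReal_re]
    have hn : ‖Complex.polarCoord.symm (s, θ)‖ = s := by
      rw [Complex.norm_polarCoord_symm, abs_of_pos hs]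
    have hcos : Real.cos α * s < s * Real.cos θ ↔ θ ∈ Ioo (-α) α := by
      rw [mul_comm, mul_lt_mul_iff_right₀ hs, ← Real.cos_abs θ,
        Real.strictAntiOn_cos.lt_iff_gt ⟨hα, hαπ⟩ ⟨abs_nonneg _, abs_le.2 ⟨hθ1.le, hθ2.le⟩⟩,
        abs_lt, mem_Ioo]
    have hmem : Complex.polarCoord.symm (s, θ) ∈ T ↔ s ∈ Ico a b ∧ θ ∈ Ioo (-α) α := by
      rw [← hcos, hT, mem_ofPred_eq, hn, hre, mem_Ico, and_assoc]
    by_cases h1 : s ∈ Ico a b <;> by_cases h2 : θ ∈ Ioo (-α) α <;>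
      simp only [indicator, hmem, h1, h2] <;> simp
  calc volume T = ∫⁻ w, T.indicator (fun _ => (1 : ℝ≥0∞)) w := by
        rw [lintegral_indicator hTm]; simp
    _ = ∫⁻ p in polarCoord.target, (Ico a b).indicator (fun s => ENNReal.ofReal s) p.1 *
          (Ioo (-α) α).indicator (fun _ => (1 : ℝ≥0∞)) p.2 := by
        rw [← Complex.lintegral_comp_polarCoord_symm]
        exact setLIntegral_congr_fun polarCoord.open_target.measurableSet key
    _ = (∫⁻ s in Ico a b, ENNReal.ofReal s) * volume (Ioo (-α) α) := by
        rw [polarCoord_target, Measure.volume_eq_prod, ← Measure.prod_restrict, lintegral_prod_mul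
          (ENNReal.measurable_ofReal.indicator measurableSet_Ico).aemeasurable
          (measurable_const.indicator measurableSet_Ioo).aemeasurable,
          lintegral_indicator measurableSet_Ico, lintegral_indicator measurableSet_Ioo,
          Measure.restrict_restrict measurableSet_Ico, Measure.restrict_restrict measurableSet_Ioo,
          inter_eq_self_of_subset_left (show Ico a b ⊆ Ioi 0 from fun s hs => ha.trans_le hs.1),
          inter_eq_self_of_subset_left (Ioo_subset_Ioo (neg_le_neg hαπ) hαπ)]
        simp
    _ = ENNReal.ofReal (α * (b ^ 2 - a ^ 2)) := by
        have hI : ∫⁻ s in Ico a b, ENNReal.ofReal s = ENNReal.ofReal ((b ^ 2 - a ^ 2) / 2) := by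
          rw [← integral_id, intervalIntegral.integral_of_le hab,
            restrict_Ico_eq_restrict_Ioc,
            ofReal_integral_eq_lintegral_ofReal]
          · exact (continuous_id.integrableOn_Icc).mono_set Ioc_subset_Icc_self
          · exact (ae_restrict_mem measurableSet_Ioc).mono fun s hs => (ha.trans hs.1).le
        rw [hI, Real.volume_Ioo, ← ENNReal.ofReal_mul (by nlinarith)]
        congr 1; ring

/-- The area of a circular sector of half-angle `α` about the direction `u`. -/
lemma volume_sector {u : EuclideanSpace ℝ (Fin 2)} (hu : ‖u‖ = 1) {a b α : ℝ} (ha : 0 < a)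
    (hab : a ≤ b) (hα : 0 ≤ α) (hαπ : α ≤ Real.pi) :
    volume.real {y : EuclideanSpace ℝ (Fin 2) |
        a ≤ ‖y‖ ∧ ‖y‖ < b ∧ Real.cos α * ‖y‖ < inner ℝ u y} = α * (b ^ 2 - a ^ 2) := by
  let L := Complex.orthonormalBasisOneI.repr.symm
  let w : Circle := ⟨L u, mem_sphere_zero_iff_norm.2 (by rw [L.norm_map, hu])⟩
  let R := L.trans (rotation w⁻¹)
  have hR : ∀ y, (R y).re = inner ℝ u y := by
    intro y
    have : R y = (starRingEnd ℂ) (L u) * L y := by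
      simp only [R, LinearIsometryEquiv.trans_apply, rotation_apply, Circle.coe_inv_eq_conj]; rfl
    rw [this, ← L.inner_map_map, Complex.inner, mul_comm]
  have hset : {y : EuclideanSpace ℝ (Fin 2) |
        a ≤ ‖y‖ ∧ ‖y‖ < b ∧ Real.cos α * ‖y‖ < inner ℝ u y} =
      R ⁻¹' {w : ℂ | a ≤ ‖w‖ ∧ ‖w‖ < b ∧ Real.cos α * ‖w‖ < w.re} := by
    ext y
    simp only [mem_preimage, mem_ofPred_eq, hR, LinearIsometryEquiv.norm_map]
  rw [hset, measureReal_def,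
    R.measurePreserving.measure_preimage_emb R.toMeasurableEquiv.measurableEmbedding,
    volume_complex_sector ha hab hα hαπ, ENNReal.toReal_ofReal]
  exact mul_nonneg hα (by nlinarith)

end SectorArea

section Slicing

/-- The Cartesian coordinates of the Euclidean plane. -/
def planeCoords : EuclideanSpace ℝ (Fin 2) ≃ᵐ ℝ × ℝ :=
  (MeasurableEquiv.toLp 2 (Fin 2 → ℝ)).symm.trans MeasurableEquiv.finTwoArrow

lemma planeCoords_apply (x : EuclideanSpace ℝ (Fin 2)) : planeCoords x = (x 0, x 1) := rfl

lemma planeCoords_symm_apply (p : ℝ × ℝ) : planeCoords.symm p = !₂[p.1, p.2] := rfl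

lemma measurePreserving_planeCoords : MeasurePreserving planeCoords volume volume :=
  (volume_preserving_finTwoArrow ℝ).comp
    (EuclideanSpace.volume_preserving_symm_measurableEquiv_toLp (Fin 2))

/-- A set over the interval `[-a, a]` all of whose vertical sections have diameter at most `w`
has area at most `2 * a * w`. -/
lemma volume_le_of_sections {T : Set (EuclideanSpace ℝ (Fin 2))} (hT : MeasurableSet T) {a w : ℝ}
    (ha : 0 ≤ a) (hw : 0 ≤ w) (hTa : ∀ x ∈ T, |x 0| ≤ a)
    (hTw : ∀ x ∈ T, ∀ y ∈ T, x 0 = y 0 → |x 1 - y 1| ≤ w) :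
    volume.real T ≤ 2 * a * w := by
  have hvol : volume T = volume (planeCoords.symm ⁻¹' T) :=
    ((measurePreserving_planeCoords.symm planeCoords).measure_preimage_equiv T).symm
  have hm : MeasurableSet (planeCoords.symm ⁻¹' T) := planeCoords.symm.measurable hT
  have hle : volume T ≤ ENNReal.ofReal (2 * a * w) := by
    rw [hvol, Measure.volume_eq_prod, Measure.prod_apply hm]
    calc ∫⁻ s, volume (Prod.mk s ⁻¹' (planeCoords.symm ⁻¹' T))
        ≤ ∫⁻ s, (Icc (-a) a).indicator (fun _ => ENNReal.ofReal w) s := by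
          refine lintegral_mono fun s => ?_
          by_cases hs : s ∈ Icc (-a) a
          · rw [indicator_of_mem hs]
            refine (Real.volume_le_diam _).trans (ediam_le fun p hp q hq => ?_)
            rw [edist_dist, Real.dist_eq]
            exact ENNReal.ofReal_le_ofReal (hTw _ hp _ hq rfl)
          · rw [indicator_of_notMem hs, nonpos_iff_eq_zero]
            rw [show Prod.mk s ⁻¹' (planeCoords.symm ⁻¹' T) = ∅ from
              eq_empty_of_forall_notMem fun p hp => hs (abs_le.1 (hTa _ hp)), measure_empty]
      _ = ENNReal.ofReal (2 * a * w) := by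
          rw [lintegral_indicator measurableSet_Icc, setLIntegral_const, Real.volume_Icc,
            ← ENNReal.ofReal_mul hw]
          congr 1; ring
  exact ENNReal.toReal_le_of_le_ofReal (by positivity) hle

end Slicing

section PerturbedAnnulus

/-- The point `(0, 1)`. -/
def northPole : EuclideanSpace ℝ (Fin 2) := !₂[0, 1]

/-- The half-open annulus `B(0, 1) \ B(0, 0.99)`. -/
def thinAnnulus : Set (EuclideanSpace ℝ (Fin 2)) := ball 0 1 \ ball 0 (99 / 100)

/-- The disc in which the annulus is perturbed. -/
def poleDisc : Set (EuclideanSpace ℝ (Fin 2)) := ball northPole (1 / 10000)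

/-- The annulus with the part inside a small disc centred on its outer boundary swapped across
that boundary. -/
def perturbedAnnulus : Set (EuclideanSpace ℝ (Fin 2)) :=
  (thinAnnulus \ poleDisc) ∪ (poleDisc \ ball 0 1)

lemma mem_thinAnnulus {y : EuclideanSpace ℝ (Fin 2)} :
    y ∈ thinAnnulus ↔ 99 / 100 ≤ ‖y‖ ∧ ‖y‖ < 1 := by
  rw [thinAnnulus, Set.mem_sdiff, mem_ball_zero_iff, mem_ball_zero_iff, not_lt, and_comm]

lemma plane_norm_sq (y : EuclideanSpace ℝ (Fin 2)) : ‖y‖ ^ 2 = y 0 ^ 2 + y 1 ^ 2 := by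
  rw [EuclideanSpace.norm_sq_eq, Fin.sum_univ_two, Real.norm_eq_abs, Real.norm_eq_abs, sq_abs,
    sq_abs]

lemma mem_poleDisc {y : EuclideanSpace ℝ (Fin 2)} :
    y ∈ poleDisc ↔ y 0 ^ 2 + (y 1 - 1) ^ 2 < (1 / 10000) ^ 2 := by
  rw [poleDisc, mem_ball, dist_eq_norm, ← sq_lt_sq₀ (norm_nonneg _) (by norm_num), plane_norm_sq]
  simp [northPole]

lemma abs_fst_le_of_mem_poleDisc {y : EuclideanSpace ℝ (Fin 2)} (hy : y ∈ poleDisc) :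
    |y 0| ≤ 1 / 10000 :=
  abs_le_of_sq_le_sq (by nlinarith [mem_poleDisc.1 hy, sq_nonneg (y 1 - 1)]) (by norm_num)

lemma abs_snd_sub_one_le_of_mem_poleDisc {y : EuclideanSpace ℝ (Fin 2)} (hy : y ∈ poleDisc) :
    |y 1 - 1| ≤ 1 / 10000 :=
  abs_le_of_sq_le_sq (by nlinarith [mem_poleDisc.1 hy, sq_nonneg (y 0)]) (by norm_num)

lemma norm_lt_of_mem_poleDisc {y : EuclideanSpace ℝ (Fin 2)} (hy : y ∈ poleDisc) :
    ‖y‖ < 10001 / 10000 := by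
  have h1 : ‖northPole‖ = 1 := by
    rw [← sq_eq_sq₀ (norm_nonneg _) zero_le_one, plane_norm_sq]; simp [northPole]
  have h2 : ‖y - northPole‖ < 1 / 10000 := by rwa [← dist_eq_norm]
  linarith [norm_le_norm_add_norm_sub' y northPole]

lemma measurableSet_poleDisc : MeasurableSet poleDisc := measurableSet_ball

lemma measurableSet_thinAnnulus : MeasurableSet thinAnnulus :=
  measurableSet_ball.diff measurableSet_ball

lemma measurableSet_perturbedAnnulus : MeasurableSet perturbedAnnulus :=
  (measurableSet_thinAnnulus.diff measurableSet_poleDisc).union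
    (measurableSet_poleDisc.diff measurableSet_ball)

lemma norm_bounds_of_mem_perturbedAnnulus {y : EuclideanSpace ℝ (Fin 2)}
    (hy : y ∈ perturbedAnnulus) : 99 / 100 ≤ ‖y‖ ∧ ‖y‖ < 10001 / 10000 := by
  rcases hy with ⟨h, -⟩ | ⟨h, h'⟩
  · exact ⟨(mem_thinAnnulus.1 h).1, (mem_thinAnnulus.1 h).2.trans (by norm_num)⟩
  · rw [mem_ball_zero_iff, not_lt] at h'
    exact ⟨le_trans (by norm_num) h', norm_lt_of_mem_poleDisc h⟩

lemma perturbedAnnulus_inter_ball : perturbedAnnulus ∩ ball 0 1 = thinAnnulus \ poleDisc := by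
  ext y
  simp only [perturbedAnnulus, thinAnnulus, mem_inter_iff, mem_union, Set.mem_sdiff]
  tauto

lemma volume_real_plane_ball (z : EuclideanSpace ℝ (Fin 2)) {r : ℝ} (hr : 0 ≤ r) :
    volume.real (ball z r) = r ^ 2 * Real.pi := by
  rw [measureReal_def, EuclideanSpace.volume_ball_fin_two, ENNReal.toReal_mul, ENNReal.toReal_pow,
    ENNReal.toReal_ofReal hr, ENNReal.toReal_ofReal Real.pi_pos.le]

lemma volume_thinAnnulus : volume.real thinAnnulus = 199 / 10000 * Real.pi := by
  rw [thinAnnulus, measureReal_sdiff (ball_subset_ball (by norm_num)) measurableSet_ball,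
    volume_real_plane_ball _ (by norm_num), volume_real_plane_ball _ (by norm_num)]
  ring

lemma volume_thinAnnulus_diff_le :
    volume.real (thinAnnulus \ poleDisc) ≤ 199 / 10000 * Real.pi :=
  volume_thinAnnulus ▸ measureReal_mono sdiff_subset
    (measure_ne_top_of_subset sdiff_subset measure_ball_lt_top.ne)

lemma le_volume_thinAnnulus_diff :
    1989999 / 100000000 * Real.pi ≤ volume.real (thinAnnulus \ poleDisc) := by
  have h := le_measureReal_sdiff (μ := volume) (s₁ := thinAnnulus) (s₂ := poleDisc)
    measure_ball_lt_top.ne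
  rw [volume_thinAnnulus, poleDisc, volume_real_plane_ball _ (by norm_num)] at h
  rw [poleDisc]
  linarith

/-- The part of the small disc in a circular shell has area controlled by the thickness of the
shell. -/
lemma volume_poleDisc_inter_shell_le {a R : ℝ} (ha : 0 ≤ a) (haR : a ≤ R) :
    volume.real (poleDisc ∩ {y | a ≤ ‖y‖ ∧ ‖y‖ < R}) ≤ 101 / 1000000 * (R ^ 2 - a ^ 2) := by
  have hm : MeasurableSet (poleDisc ∩ {y | a ≤ ‖y‖ ∧ ‖y‖ < R}) :=
    measurableSet_poleDisc.inter ((measurableSet_le measurable_const measurable_norm).inter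
      (measurableSet_lt measurable_norm measurable_const))
  have hRa : 0 ≤ R ^ 2 - a ^ 2 := by nlinarith
  refine (volume_le_of_sections hm (a := 1 / 10000) (w := (R ^ 2 - a ^ 2) / (199 / 100))
    (by norm_num) (by positivity) (fun x hx => abs_fst_le_of_mem_poleDisc hx.1) ?_).trans ?_
  · have key : ∀ x ∈ poleDisc ∩ {y | a ≤ ‖y‖ ∧ ‖y‖ < R}, ∀ y ∈ poleDisc ∩ {y | a ≤ ‖y‖ ∧ ‖y‖ < R},
        x 0 = y 0 → x 1 - y 1 ≤ (R ^ 2 - a ^ 2) / (199 / 100) := by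
      rintro x ⟨hx, -, hxR⟩ y ⟨hy, hya, -⟩ hxy
      rw [le_div_iff₀ (by norm_num)]
      have h1 := plane_norm_sq x
      have h2 := plane_norm_sq y
      have h3 := (abs_le.1 (abs_snd_sub_one_le_of_mem_poleDisc hx)).1
      have h4 := (abs_le.1 (abs_snd_sub_one_le_of_mem_poleDisc hy)).1
      have h5 : ‖x‖ ^ 2 ≤ R ^ 2 := pow_le_pow_left₀ (norm_nonneg _) hxR.le 2
      have h6 : a ^ 2 ≤ ‖y‖ ^ 2 := pow_le_pow_left₀ ha hya 2
      rw [hxy] at h1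
      rcases le_total (x 1) (y 1) with h | h <;> nlinarith
    exact fun x hx y hy hxy => abs_sub_le_iff.2 ⟨key x hx y hy hxy, key y hy x hx hxy.symm⟩
  · nlinarith

lemma volume_poleDisc_inter_le (T : Set (EuclideanSpace ℝ (Fin 2))) :
    volume.real (poleDisc ∩ T) ≤ 1 / 100000000 * Real.pi := by
  refine (measureReal_mono inter_subset_left measure_ball_lt_top.ne).trans_eq ?_
  rw [volume_real_plane_ball _ (by norm_num)]
  norm_num

lemma norm_sub_smul_sq {u : EuclideanSpace ℝ (Fin 2)} (hu : ‖u‖ = 1) (t : ℝ)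
    (y : EuclideanSpace ℝ (Fin 2)) :
    ‖y - t • u‖ ^ 2 = ‖y‖ ^ 2 - 2 * t * inner ℝ u y + t ^ 2 := by
  rw [norm_sub_sq_real, norm_smul, inner_smul_right, hu, real_inner_comm, mul_one,
    Real.norm_eq_abs, sq_abs]
  ring

/-- A small ball meets the perturbed annulus only inside a sector about its centre direction. -/
lemma volume_perturbedAnnulus_inter_ball_le {u : EuclideanSpace ℝ (Fin 2)} (hu : ‖u‖ = 1)
    {t r α : ℝ} (ht : 0 ≤ t) (hr : 0 < r) (hα : 0 ≤ α) (hαπ : α ≤ Real.pi)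
    (hrα : r ^ 2 ≤ (99 / 100) ^ 2 * (1 - Real.cos α ^ 2)) :
    volume.real (perturbedAnnulus ∩ ball (t • u) r) ≤ α * (2010001 / 100000000) := by
  have h := volume_sector hu (a := 99 / 100) (b := 10001 / 10000) (by norm_num) (by norm_num) hα hαπ
  refine (measureReal_mono ?_ ?_).trans (h.trans_le (by norm_num))
  · rintro y ⟨hy, hyr⟩
    obtain ⟨h1, h2⟩ := norm_bounds_of_mem_perturbedAnnulus hy
    refine ⟨h1, h2, ?_⟩
    by_contra! hc
    rw [mem_ball, dist_eq_norm, ← sq_lt_sq₀ (norm_nonneg _) hr.le, norm_sub_smul_sq hu] at hyr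
    have h3 : (99 / 100) ^ 2 ≤ ‖y‖ ^ 2 := pow_le_pow_left₀ (by norm_num) h1 2
    have h4 : 0 ≤ 1 - Real.cos α ^ 2 := by linarith [Real.cos_sq_le_one α]
    nlinarith [sq_nonneg (t - Real.cos α * ‖y‖), mul_le_mul_of_nonneg_left hc ht,
      mul_le_mul_of_nonneg_right h3 h4]
  · exact measure_ne_top_of_subset (s := ball (0 : EuclideanSpace ℝ (Fin 2)) (10001 / 10000))
      (fun y hy => mem_ball_zero_iff.2 hy.2.1) measure_ball_lt_top.ne

/-- Trading the sector of a thin shell opposite to the centre of a ball, which the ball misses,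
against the part of the small disc the ball may gain. -/
lemma volume_perturbedAnnulus_inter_ball_add_le {u : EuclideanSpace ℝ (Fin 2)} (hu : ‖u‖ = 1)
    {t r τ R : ℝ} (ht : 0 ≤ t) (hr : 0 < r) (hτ : 0 ≤ τ) (hτ' : τ ≤ 1 / 100)
    (hτr : τ ≤ 1 - r + t / 2 ∨ τ = 0) (hR : 1 ≤ R) (hrt : r + t ≤ R) :
    volume.real (perturbedAnnulus ∩ ball (t • u) r) + Real.pi / 3 * (1 - (1 - τ) ^ 2) ≤
      volume.real (thinAnnulus \ poleDisc) +
        volume.real (poleDisc ∩ {y | 1 - τ ≤ ‖y‖ ∧ ‖y‖ < R}) := by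
  set Λ : Set (EuclideanSpace ℝ (Fin 2)) := {y | 1 - τ ≤ ‖y‖ ∧ ‖y‖ < 1 ∧
    Real.cos (Real.pi / 3) * ‖y‖ < inner ℝ (-u) y} with hΛ
  have hΛv : volume.real Λ = Real.pi / 3 * (1 - (1 - τ) ^ 2) := by
    rw [hΛ, volume_sector (by rwa [norm_neg]) (by linarith) (by linarith) (by positivity)
      (by linarith [Real.pi_pos]), one_pow]
  have hΛm : MeasurableSet Λ :=
    (measurableSet_le measurable_const measurable_norm).inter
      ((measurableSet_lt measurable_norm measurable_const).inter
        (measurableSet_lt (measurable_norm.const_mul _)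
          (continuous_const.inner continuous_id).measurable))
  have hΛtop : volume Λ ≠ ∞ := measure_ne_top_of_subset (s := ball (0 : EuclideanSpace ℝ (Fin 2)) 1)
      (fun y hy => mem_ball_zero_iff.2 hy.2.1) measure_ball_lt_top.ne
  have hEtop : volume (perturbedAnnulus ∩ ball (t • u) r) ≠ ∞ :=
    measure_ne_top_of_subset inter_subset_right measure_ball_lt_top.ne
  have hdisj : Disjoint (perturbedAnnulus ∩ ball (t • u) r) Λ := by
    rw [Set.disjoint_left]
    rintro y ⟨-, hyr⟩ ⟨h1, h2, h3⟩
    rcases hτr with hτr | hτr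
    · rw [mem_ball, dist_eq_norm, ← sq_lt_sq₀ (norm_nonneg _) hr.le, norm_sub_smul_sq hu] at hyr
      rw [inner_neg_left, Real.cos_pi_div_three] at h3
      have h4 : r ^ 2 ≤ (‖y‖ + t / 2) ^ 2 := pow_le_pow_left₀ hr.le (by linarith) 2
      nlinarith
    · linarith
  have hGtop : volume (poleDisc ∩ {y | 1 - τ ≤ ‖y‖ ∧ ‖y‖ < R}) ≠ ∞ :=
    measure_ne_top_of_subset inter_subset_left measure_ball_lt_top.ne
  have hAtop : volume (thinAnnulus \ poleDisc) ≠ ∞ :=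
    measure_ne_top_of_subset (s := ball 0 1) (sdiff_subset.trans sdiff_subset) measure_ball_lt_top.ne
  rw [← hΛv, ← measureReal_union hdisj hΛm hEtop hΛtop]
  refine (measureReal_mono ?_ ?_).trans (measureReal_union_le _ _)
  · rintro y (⟨hy | ⟨hy, hy'⟩, hyr⟩ | ⟨h1, h2, -⟩)
    · exact Or.inl hy
    · rw [mem_ball_zero_iff, not_lt] at hy'
      refine Or.inr ⟨hy, by linarith, ?_⟩
      rw [mem_ball, dist_eq_norm] at hyr
      have h5 := norm_le_norm_add_norm_sub' y (t • u)
      rw [norm_smul, hu, mul_one, Real.norm_of_nonneg ht] at h5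
      linarith
    · by_cases hy : y ∈ poleDisc
      · exact Or.inr ⟨hy, h1, h2.trans_le hR⟩
      · exact Or.inl ⟨mem_thinAnnulus.2 ⟨by linarith, h2⟩, hy⟩
  · exact (measure_union_lt_top hAtop.lt_top hGtop.lt_top).ne

lemma volume_perturbedAnnulus_inter_ball_lt_of_one_le {u : EuclideanSpace ℝ (Fin 2)} (hu : ‖u‖ = 1)
    {t r : ℝ} (ht : 0 ≤ t) (hr : 1 ≤ r) (hne : t = 0 → r ≠ 1) :
    volume.real (perturbedAnnulus ∩ ball (t • u) r) <
      r ^ 2 * volume.real (thinAnnulus \ poleDisc) := by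
  have hπ1 := Real.pi_gt_d2
  have hπ2 := Real.pi_lt_d2
  have hm1 : 624 / 10000 ≤ volume.real (thinAnnulus \ poleDisc) :=
    le_trans (by linarith) le_volume_thinAnnulus_diff
  set m := volume.real (thinAnnulus \ poleDisc)
  obtain ⟨s, rfl⟩ : ∃ s, r = 1 + s := ⟨r - 1, by ring⟩
  have hs : 0 ≤ s := by linarith
  have hgain : 2 * s * (624 / 10000) ≤ ((1 + s) ^ 2 - 1) * m := by
    nlinarith [mul_nonneg hs hs, mul_nonneg hs (sub_nonneg.2 hm1)]
  have key : ∀ τ : ℝ, 0 ≤ τ → τ ≤ 1 / 100 → (τ ≤ 1 - (1 + s) + t / 2 ∨ τ = 0) →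
      volume.real (perturbedAnnulus ∩ ball (t • u) (1 + s)) + 2 * τ ≤ m + 4 / 100000000 ∧
      volume.real (perturbedAnnulus ∩ ball (t • u) (1 + s)) + 2 * τ ≤
        m + 101 / 1000000 * ((1 + s + t) ^ 2 - (1 - τ) ^ 2) := by
    intro τ h0 h1 h2
    have h := volume_perturbedAnnulus_inter_ball_add_le hu ht (by linarith : 0 < 1 + s) h0 h1 h2
      (by linarith : 1 ≤ 1 + s + t) le_rfl
    have hG1 := volume_poleDisc_inter_le {y | 1 - τ ≤ ‖y‖ ∧ ‖y‖ < 1 + s + t}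
    have hG2 := volume_poleDisc_inter_shell_le (by linarith : 0 ≤ 1 - τ)
      (by linarith : 1 - τ ≤ 1 + s + t)
    have hτ : 2 * τ ≤ Real.pi / 3 * (1 - (1 - τ) ^ 2) := by
      nlinarith [mul_nonneg h0 (sub_nonneg.2 h1), mul_nonneg h0 (sub_nonneg.2 hπ1.le),
        mul_nonneg (mul_nonneg h0 (sub_nonneg.2 h1)) (sub_nonneg.2 hπ1.le)]
    constructor <;> linarith
  rcases lt_or_ge (1 / 100) s with hs' | hs'
  · have := (key 0 le_rfl (by norm_num) (Or.inr rfl)).1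
    linarith
  · rcases le_or_gt t (2 * s) with hts | hts
    · have hs0 : 0 < s := by
        rcases hs.eq_or_lt with h | h
        · exact absurd (by linarith) (hne (by linarith))
        · exact h
      have := (key 0 le_rfl (by norm_num) (Or.inr rfl)).2
      nlinarith
    · rcases le_or_gt (1 / 100) (t / 2 - s) with hτ | hτ
      · have := (key (1 / 100) (by norm_num) le_rfl (Or.inl (by linarith))).1
        linarith
      · have := (key (t / 2 - s) (by linarith) hτ.le (Or.inl (by linarith))).2
        have hfac : (1 + s + t) ^ 2 - (1 - (t / 2 - s)) ^ 2 = (3 * t / 2) * (2 + 2 * s + t / 2) := by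
          ring
        rw [hfac] at this
        nlinarith

lemma volume_perturbedAnnulus_inter_ball_lt_of_lt_one {u : EuclideanSpace ℝ (Fin 2)} (hu : ‖u‖ = 1)
    {t r : ℝ} (ht : 0 ≤ t) (hr : 857 / 1000 ≤ r) (hr1 : r < 1) :
    volume.real (perturbedAnnulus ∩ ball (t • u) r) <
      r ^ 2 * volume.real (thinAnnulus \ poleDisc) := by
  have hπ1 := Real.pi_gt_d2
  have hπ2 := Real.pi_lt_d2
  have hm1 : volume.real (thinAnnulus \ poleDisc) ≤ 627 / 10000 :=
    volume_thinAnnulus_diff_le.trans (by linarith)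
  have hm0 : 0 ≤ volume.real (thinAnnulus \ poleDisc) := measureReal_nonneg
  set m := volume.real (thinAnnulus \ poleDisc)
  obtain ⟨s, rfl⟩ : ∃ s, r = 1 - s := ⟨1 - r, by ring⟩
  have hs : 0 < s := by linarith
  have hloss : (1 - (1 - s) ^ 2) * m ≤ (2 * s - s ^ 2) * (627 / 10000) := by
    nlinarith [mul_nonneg (by nlinarith : 0 ≤ 2 * s - s ^ 2) (sub_nonneg.2 hm1)]
  have key : ∀ τ : ℝ, 0 ≤ τ → τ ≤ 1 / 100 → τ ≤ s + t / 2 →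
      volume.real (perturbedAnnulus ∩ ball (t • u) (1 - s)) + 2 * τ ≤ m + 4 / 100000000 ∧
      volume.real (perturbedAnnulus ∩ ball (t • u) (1 - s)) + 2 * τ ≤
        m + 101 / 1000000 * ((1 + t) ^ 2 - (1 - τ) ^ 2) := by
    intro τ h0 h1 h2
    have h := volume_perturbedAnnulus_inter_ball_add_le hu ht (by linarith : 0 < 1 - s) h0 h1
      (Or.inl (by linarith)) (by linarith : 1 ≤ 1 + t) (by linarith)
    have hG1 := volume_poleDisc_inter_le {y | 1 - τ ≤ ‖y‖ ∧ ‖y‖ < 1 + t}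
    have hG2 := volume_poleDisc_inter_shell_le (by linarith : 0 ≤ 1 - τ)
      (by linarith : 1 - τ ≤ 1 + t)
    have hτ : 2 * τ ≤ Real.pi / 3 * (1 - (1 - τ) ^ 2) := by
      nlinarith [mul_nonneg h0 (sub_nonneg.2 h1), mul_nonneg h0 (sub_nonneg.2 hπ1.le),
        mul_nonneg (mul_nonneg h0 (sub_nonneg.2 h1)) (sub_nonneg.2 hπ1.le)]
    constructor <;> linarith
  rcases le_or_gt (1 / 100) (s + t / 2) with hτ | hτ
  · have := (key (1 / 100) (by norm_num) le_rfl hτ).1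
    nlinarith
  · have := (key (s + t / 2) (by linarith) hτ.le le_rfl).2
    have hfac : (1 + t) ^ 2 - (1 - (s + t / 2)) ^ 2 = (3 * t / 2 + s) * (2 + t / 2 - s) := by
      ring
    rw [hfac] at this
    nlinarith

/-- Among the balls meeting `B(0, 0.01)`, the unit ball has the largest density ratio. -/
lemma volume_perturbedAnnulus_inter_ball_lt {x z : EuclideanSpace ℝ (Fin 2)} {r : ℝ} (hr : 0 < r)
    (hx : ‖x‖ < 1 / 100) (hxz : dist x z ≤ r) (hne : ¬(z = 0 ∧ r = 1)) :
    volume.real (perturbedAnnulus ∩ ball z r) <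
      r ^ 2 * volume.real (thinAnnulus \ poleDisc) := by
  have hm := le_volume_thinAnnulus_diff
  have hπ := Real.pi_pos
  obtain ⟨u, t, hu, ht, rfl⟩ : ∃ (u : EuclideanSpace ℝ (Fin 2)) (t : ℝ),
      ‖u‖ = 1 ∧ 0 ≤ t ∧ z = t • u := by
    by_cases hz : z = 0
    · exact ⟨EuclideanSpace.single 0 1, 0, by simp, le_rfl, by simp [hz]⟩
    · refine ⟨‖z‖⁻¹ • z, ‖z‖, norm_smul_inv_norm hz, norm_nonneg _, ?_⟩
      rw [smul_inv_smul₀ (norm_ne_zero_iff.2 hz)]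
  have hsector : ∀ α : ℝ, 0 ≤ α → α ≤ Real.pi →
      r ^ 2 ≤ (99 / 100) ^ 2 * (1 - Real.cos α ^ 2) → α * (2010001 / 100000000) <
        r ^ 2 * (1989999 / 100000000 * Real.pi) →
      volume.real (perturbedAnnulus ∩ ball (t • u) r) <
        r ^ 2 * volume.real (thinAnnulus \ poleDisc) := fun α h0 h1 h2 h3 =>
    ((volume_perturbedAnnulus_inter_ball_le hu ht hr h0 h1 h2).trans_lt h3).trans_le
      (mul_le_mul_of_nonneg_left hm (sq_nonneg r))
  rcases lt_or_ge r (49 / 100) with h | h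
  · have hempty : perturbedAnnulus ∩ ball (t • u) r = ∅ := by
      refine eq_empty_of_forall_notMem ?_
      rintro y ⟨hy, hyr⟩
      have h1 := (norm_bounds_of_mem_perturbedAnnulus hy).1
      have h2 := dist_triangle4 y (t • u) x 0
      rw [mem_ball] at hyr
      rw [dist_zero_right, dist_zero_right, dist_comm (t • u) x] at h2
      linarith
    rw [hempty, measureReal_empty]
    have : 0 < volume.real (thinAnnulus \ poleDisc) := lt_of_lt_of_le (by positivity) hm
    positivity
  rcases le_or_gt r (581 / 1000) with h' | h'
  · refine hsector (Real.pi / 5) (by positivity) (by linarith) ?_ ?_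
    · have h5 : √5 ^ 2 = 5 := Real.sq_sqrt (by norm_num)
      have h5' : √5 ≤ 2.2361 := Real.sqrt_le_iff.2 ⟨by norm_num, by norm_num⟩
      rw [Real.cos_pi_div_five]
      nlinarith
    · nlinarith [mul_le_mul_of_nonneg_right (pow_le_pow_left₀ (by norm_num) h 2) hπ.le]
  rcases le_or_gt r (857 / 1000) with h'' | h''
  · refine hsector (Real.pi / 3) (by positivity) (by linarith) ?_ ?_
    · rw [Real.cos_pi_div_three]
      nlinarith
    · nlinarith [mul_le_mul_of_nonneg_right (pow_le_pow_left₀ (by norm_num) h'.le 2) hπ.le]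
  rcases lt_or_ge r 1 with h1 | h1
  · exact volume_perturbedAnnulus_inter_ball_lt_of_lt_one hu ht h''.le h1
  · exact volume_perturbedAnnulus_inter_ball_lt_of_one_le hu ht h1
      fun h0 h1 => hne ⟨by rw [h0, zero_smul], h1⟩

lemma perturbedAnnulus_ratio_lt {x z : EuclideanSpace ℝ (Fin 2)} {r : ℝ} (hr : 0 < r)
    (hx : ‖x‖ < 1 / 100) (hxz : dist x z ≤ r) (hne : ¬(z = 0 ∧ r = 1)) :
    volume (perturbedAnnulus ∩ ball z r) / volume (ball z r) <
      volume (perturbedAnnulus ∩ ball 0 1) /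
        volume (ball (0 : EuclideanSpace ℝ (Fin 2)) 1) := by
  have hreal : ∀ (w : EuclideanSpace ℝ (Fin 2)) {s : ℝ}, 0 < s →
      volume (perturbedAnnulus ∩ ball w s) / volume (ball w s) =
        ENNReal.ofReal (volume.real (perturbedAnnulus ∩ ball w s) / (s ^ 2 * Real.pi)) := by
    intro w s hs
    rw [ENNReal.ofReal_div_of_pos (mul_pos (pow_pos hs 2) Real.pi_pos),
      ← volume_real_plane_ball w hs.le, ofReal_measureReal measure_ball_lt_top.ne,
      ofReal_measureReal (measure_ne_top_of_subset inter_subset_right measure_ball_lt_top.ne)]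
  have hlt := volume_perturbedAnnulus_inter_ball_lt hr hx hxz hne
  have hm : 0 < volume.real (thinAnnulus \ poleDisc) :=
    lt_of_lt_of_le (by positivity) le_volume_thinAnnulus_diff
  rw [hreal z hr, hreal 0 one_pos, perturbedAnnulus_inter_ball, one_pow, one_mul]
  refine (ENNReal.ofReal_lt_ofReal_iff (by positivity)).2 ?_
  rw [div_lt_div_iff₀ (by positivity) Real.pi_pos]
  nlinarith [mul_lt_mul_of_pos_right hlt Real.pi_pos]

theorem maxFnInd_perturbedAnnulus {x : EuclideanSpace ℝ (Fin 2)} (hx : ‖x‖ < 1 / 100) :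
    maxFnInd perturbedAnnulus x = volume (perturbedAnnulus ∩ ball 0 1) /
        volume (ball (0 : EuclideanSpace ℝ (Fin 2)) 1) := by
  refine le_antisymm ?_ ?_
  · refine iSup_le fun z => iSup_le fun r => iSup_le fun hr => iSup_le fun hxz => ?_
    by_cases h : z = 0 ∧ r = 1
    · rw [h.1, h.2]
    · exact (perturbedAnnulus_ratio_lt hr hx (mem_ball.1 hxz).le h).le
  · refine le_iSup_of_le 0 (le_iSup_of_le 1 (le_iSup_of_le one_pos (le_iSup_of_le ?_ le_rfl)))
    exact mem_ball_zero_iff.2 (hx.trans (by norm_num))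

end PerturbedAnnulus

section RadialCutoff

/-- A smooth radial cutoff passing from `1` to `0` where `s * (1 - ‖x‖ ^ 2) + k` decreases
from `1` to `0`. -/
def radialCutoff (s k : ℝ) (x : EuclideanSpace ℝ (Fin 2)) : ℝ :=
  Real.smoothTransition (s * (1 - ‖x‖ ^ 2) + k)

/-- The derivative of `radialCutoff s k` in the second coordinate. -/
def radialCutoffDeriv (s k : ℝ) (x : EuclideanSpace ℝ (Fin 2)) : ℝ :=
  deriv Real.smoothTransition (s * (1 - ‖x‖ ^ 2) + k) * -(s * (2 * x 1))

lemma radialCutoff_of_one_le {s k : ℝ} {x : EuclideanSpace ℝ (Fin 2)}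
    (h : 1 ≤ s * (1 - ‖x‖ ^ 2) + k) : radialCutoff s k x = 1 :=
  Real.smoothTransition.one_of_one_le h

lemma radialCutoff_of_nonpos {s k : ℝ} {x : EuclideanSpace ℝ (Fin 2)}
    (h : s * (1 - ‖x‖ ^ 2) + k ≤ 0) : radialCutoff s k x = 0 :=
  Real.smoothTransition.zero_of_nonpos h

lemma contDiff_radialCutoff (s k : ℝ) : ContDiff ℝ 1 (radialCutoff s k) :=
  Real.smoothTransition.contDiff.comp
    ((contDiff_const.mul (contDiff_const.sub (contDiff_norm_sq ℝ))).add contDiff_const)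

lemma hasCompactSupport_radialCutoff {s k : ℝ} (hs : 1 ≤ s) (hk : k ≤ 1) :
    HasCompactSupport (radialCutoff s k) := by
  refine HasCompactSupport.of_support_subset_isCompact (isCompact_closedBall 0 2) fun x hx => ?_
  by_contra hx2
  rw [mem_closedBall_zero_iff, not_le] at hx2
  have hx3 : 3 ≤ ‖x‖ ^ 2 - 1 := by nlinarith
  exact hx (radialCutoff_of_nonpos (by nlinarith))

lemma hasDerivAt_smoothTransition (v : ℝ) :
    HasDerivAt Real.smoothTransition (deriv Real.smoothTransition v) v :=
  ((Real.smoothTransition.contDiff (n := 1)).differentiable (by norm_num) v).hasDerivAt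

lemma deriv_smoothTransition_nonneg (v : ℝ) : 0 ≤ deriv Real.smoothTransition v :=
  Real.smoothTransition.monotone.deriv_nonneg

lemma deriv_smoothTransition_of_nonpos {v : ℝ} (hv : v ≤ 0) :
    deriv Real.smoothTransition v = 0 := by
  refine IsLocalMin.deriv_eq_zero (Eventually.of_forall fun w => ?_)
  rw [Real.smoothTransition.zero_of_nonpos hv]
  exact Real.smoothTransition.nonneg w

lemma deriv_smoothTransition_of_one_le {v : ℝ} (hv : 1 ≤ v) :
    deriv Real.smoothTransition v = 0 := by
  refine IsLocalMax.deriv_eq_zero (Eventually.of_forall fun w => ?_)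
  rw [Real.smoothTransition.one_of_one_le hv]
  exact Real.smoothTransition.le_one w

lemma radialCutoffDeriv_of_nonpos {s k : ℝ} {x : EuclideanSpace ℝ (Fin 2)}
    (h : s * (1 - ‖x‖ ^ 2) + k ≤ 0) : radialCutoffDeriv s k x = 0 := by
  rw [radialCutoffDeriv, deriv_smoothTransition_of_nonpos h, zero_mul]

lemma radialCutoffDeriv_of_one_le {s k : ℝ} {x : EuclideanSpace ℝ (Fin 2)}
    (h : 1 ≤ s * (1 - ‖x‖ ^ 2) + k) : radialCutoffDeriv s k x = 0 := by
  rw [radialCutoffDeriv, deriv_smoothTransition_of_one_le h, zero_mul]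

lemma fderiv_radialCutoff_single (s k : ℝ) (x : EuclideanSpace ℝ (Fin 2)) :
    fderiv ℝ (radialCutoff s k) x (EuclideanSpace.single 1 1) = radialCutoffDeriv s k x := by
  have h := (hasDerivAt_smoothTransition (s * (1 - ‖x‖ ^ 2) + k)).comp_hasFDerivAt x
    ((((hasStrictFDerivAt_norm_sq x).hasFDerivAt.const_sub 1).const_mul s).add_const k)
  rw [show radialCutoff s k =
    Real.smoothTransition ∘ fun x => s * (1 - ‖x‖ ^ 2) + k from rfl, h.fderiv, radialCutoffDeriv]
  simp [EuclideanSpace.inner_single_right]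

lemma continuous_radialCutoffDeriv (s k : ℝ) : Continuous (radialCutoffDeriv s k) := by
  have h : Continuous (deriv Real.smoothTransition) :=
    (Real.smoothTransition.contDiff (n := 1)).continuous_deriv le_rfl
  unfold radialCutoffDeriv
  fun_prop

lemma integrable_radialCutoffDeriv {s k : ℝ} (hs : 1 ≤ s) (hk : k ≤ 1) :
    Integrable (radialCutoffDeriv s k) := by
  refine (continuous_radialCutoffDeriv s k).integrable_of_hasCompactSupport
    (HasCompactSupport.of_support_subset_isCompact (isCompact_closedBall 0 2) fun x hx => ?_)
  by_contra hx2
  rw [mem_closedBall_zero_iff, not_le] at hx2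
  have hx3 : 3 ≤ ‖x‖ ^ 2 - 1 := by nlinarith
  exact hx (radialCutoffDeriv_of_nonpos (by nlinarith))

lemma integral_radialCutoffDeriv (s k : ℝ) : ∫ x, radialCutoffDeriv s k x = 0 := by
  have h := integral_neg_eq_self (radialCutoffDeriv s k) volume
  have hodd : ∀ x, radialCutoffDeriv s k (-x) = -radialCutoffDeriv s k x := by
    intro x
    simp [radialCutoffDeriv]
  simp only [hodd, integral_neg] at h
  linarith

lemma setIntegral_poleDisc_radialCutoffDeriv_le {s k : ℝ} (hs : 20000 ≤ s) (hk0 : 0 ≤ k)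
    (hk1 : k ≤ 1) :
    ∫ x in poleDisc, radialCutoffDeriv s k x ≤ -(1 / 10000) := by
  set I : Set ℝ := Icc (-(1 / 20000)) (1 / 20000)
  set J : Set ℝ := Icc (1 - 1 / 20000) (1 + 1 / 20000) with hJ
  have hint := integrable_radialCutoffDeriv (s := s) (by linarith) hk1
  have hsub : planeCoords ⁻¹' (I ×ˢ J) ⊆ poleDisc := by
    rintro x ⟨⟨h1, h2⟩, h3, h4⟩
    simp only [planeCoords_apply] at h1 h2 h3 h4
    exact mem_poleDisc.2 (by nlinarith)
  have hneg : ∀ x ∈ poleDisc, 0 ≤ -radialCutoffDeriv s k x := by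
    intro x hx
    have h1 := (abs_le.1 (abs_snd_sub_one_le_of_mem_poleDisc hx)).1
    rw [radialCutoffDeriv, mul_neg, neg_neg]
    exact mul_nonneg (deriv_smoothTransition_nonneg _)
      (mul_nonneg (by linarith) (by linarith))
  have hmono : ∫ x in planeCoords ⁻¹' (I ×ˢ J), -radialCutoffDeriv s k x ≤
      ∫ x in poleDisc, -radialCutoffDeriv s k x :=
    setIntegral_mono_set hint.neg.integrableOn
      ((ae_restrict_mem measurableSet_poleDisc).mono hneg) hsub.eventuallyLE
  have hcoords : ∀ x v : ℝ, ‖planeCoords.symm (x, v)‖ ^ 2 = x ^ 2 + v ^ 2 := fun x v => by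
    rw [plane_norm_sq]; rfl
  have hderiv : ∀ x v : ℝ, HasDerivAt (fun v => radialCutoff s k (planeCoords.symm (x, v)))
      (radialCutoffDeriv s k (planeCoords.symm (x, v))) v := by
    intro x v
    simp only [radialCutoff, radialCutoffDeriv, hcoords]
    refine (hasDerivAt_smoothTransition _).comp v ?_
    have := (((((hasDerivAt_pow 2 v).const_add (x ^ 2)).const_sub 1).const_mul s).add_const k)
    exact this.congr_deriv (show s * -(((2 : ℕ) : ℝ) * v ^ (2 - 1)) = -(s * (2 * v)) by norm_num)
  have hcont : Continuous fun p : ℝ × ℝ => radialCutoffDeriv s k (planeCoords.symm p) :=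
    (continuous_radialCutoffDeriv s k).comp
      (show Continuous fun p : ℝ × ℝ => (!₂[p.1, p.2] : EuclideanSpace ℝ (Fin 2)) by fun_prop)
  have hsection : ∀ x ∈ I, ∫ v in J, radialCutoffDeriv s k (planeCoords.symm (x, v)) = -1 := by
    rintro x ⟨hx1, hx2⟩
    rw [hJ, integral_Icc_eq_integral_Ioc, ← intervalIntegral.integral_of_le (by norm_num),
      intervalIntegral.integral_eq_sub_of_hasDerivAt (fun v _ => hderiv x v)
        ((hcont.comp (Continuous.prodMk_right x)).intervalIntegrable _ _),
      radialCutoff, radialCutoff, hcoords, hcoords, Real.smoothTransition.zero_of_nonpos,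
      Real.smoothTransition.one_of_one_le]
    · norm_num
    · nlinarith [mul_nonneg (sub_nonneg.2 hx1) (sub_nonneg.2 hx2)]
    · nlinarith [sq_nonneg x]
  have hrect : ∫ x in planeCoords ⁻¹' (I ×ˢ J), radialCutoffDeriv s k x = -(1 / 10000) := by
    have h := measurePreserving_planeCoords.setIntegral_preimage_emb
      planeCoords.measurableEmbedding (fun p => radialCutoffDeriv s k (planeCoords.symm p)) (I ×ˢ J)
    simp only [MeasurableEquiv.symm_apply_apply] at h
    rw [h, Measure.volume_eq_prod, setIntegral_prod _
      (hcont.continuousOn.integrableOn_compact (isCompact_Icc.prod isCompact_Icc)),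
      setIntegral_congr_fun measurableSet_Icc hsection, setIntegral_const, measureReal_def,
      Real.volume_Icc, ENNReal.toReal_ofReal (by norm_num)]
    norm_num
  rw [integral_neg, integral_neg, hrect] at hmono
  linarith

lemma setIntegral_perturbedAnnulus_radialCutoffDeriv_zero {s : ℝ} (hs : 20000 ≤ s) :
    1 / 10000 ≤ ∫ x in perturbedAnnulus, radialCutoffDeriv s 0 x := by
  have hint := integrable_radialCutoffDeriv (s := s) (by linarith) zero_le_one
  have heq : ∫ x in perturbedAnnulus, radialCutoffDeriv s 0 x =
      ∫ x in poleDiscᶜ, radialCutoffDeriv s 0 x := by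
    rw [← integral_indicator measurableSet_perturbedAnnulus,
      ← integral_indicator measurableSet_poleDisc.compl]
    congr 1
    ext x
    by_cases h1 : s * (1 - ‖x‖ ^ 2) + 0 ≤ 0
    · simp [indicator, radialCutoffDeriv_of_nonpos h1]
    by_cases h2 : 1 ≤ s * (1 - ‖x‖ ^ 2) + 0
    · simp [indicator, radialCutoffDeriv_of_one_le h2]
    have hx1 : ‖x‖ < 1 := by
      by_contra! h
      exact h1 (by nlinarith [mul_nonneg (by linarith : 0 ≤ s) (by nlinarith : 0 ≤ ‖x‖ ^ 2 - 1)])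
    have hx2 : 99 / 100 ≤ ‖x‖ := by
      by_contra! h
      have h3 : 1 / 100 ≤ 1 - ‖x‖ ^ 2 := by nlinarith [norm_nonneg x]
      exact h2 (by nlinarith)
    have hmem : x ∈ perturbedAnnulus ↔ x ∈ poleDiscᶜ := by
      have h3 : x ∈ thinAnnulus := mem_thinAnnulus.2 ⟨hx2, hx1⟩
      simp [perturbedAnnulus, h3, hx1]
    by_cases h : x ∈ poleDisc <;> simp_all [indicator]
  rw [heq]
  have h1 := integral_add_compl measurableSet_poleDisc hint
  rw [integral_radialCutoffDeriv] at h1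
  linarith [setIntegral_poleDisc_radialCutoffDeriv_le hs le_rfl zero_le_one]

lemma setIntegral_perturbedAnnulus_radialCutoffDeriv_one {s : ℝ} (hs : 20000 ≤ s) :
    ∫ x in perturbedAnnulus, radialCutoffDeriv s 1 x ≤ -(1 / 10000) := by
  refine le_of_eq_of_le ?_ (setIntegral_poleDisc_radialCutoffDeriv_le hs zero_le_one le_rfl)
  rw [← integral_indicator measurableSet_perturbedAnnulus,
    ← integral_indicator measurableSet_poleDisc]
  congr 1
  ext x
  by_cases h2 : 1 ≤ s * (1 - ‖x‖ ^ 2) + 1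
  · simp [indicator, radialCutoffDeriv_of_one_le h2]
  have hx1 : 1 < ‖x‖ := by
    by_contra! h
    have h3 : 0 ≤ 1 - ‖x‖ ^ 2 := by nlinarith [norm_nonneg x]
    exact h2 (by nlinarith)
  have hmem : x ∈ perturbedAnnulus ↔ x ∈ poleDisc := by
    have h3 : x ∉ thinAnnulus := fun h => (mem_thinAnnulus.1 h).2.not_gt hx1
    simp [perturbedAnnulus, h3, hx1.le]
  by_cases h : x ∈ poleDisc <;> simp_all [indicator]

lemma tendsto_integral_radialCutoff (ν : Measure (EuclideanSpace ℝ (Fin 2))) [IsFiniteMeasure ν]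
    {k : ℝ} {T : Set (EuclideanSpace ℝ (Fin 2))} (hT : MeasurableSet T)
    (hlim : ∀ x, ∀ᶠ n : ℕ in atTop, radialCutoff (n + 20000) k x = T.indicator 1 x) :
    Tendsto (fun n : ℕ => ∫ x, radialCutoff (n + 20000) k x ∂ν) atTop (𝓝 (ν T).toReal) := by
  rw [← measureReal_def, ← integral_indicator_one hT]
  refine tendsto_integral_of_dominated_convergence (fun _ => 1)
    (fun n => (contDiff_radialCutoff _ k).continuous.aestronglyMeasurable)
    (integrable_const 1) (fun n => Eventually.of_forall fun x => ?_)
    (Eventually.of_forall fun x => tendsto_const_nhds.congr' ((hlim x).mono fun n hn => hn.symm))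
  rw [radialCutoff, Real.norm_of_nonneg (Real.smoothTransition.nonneg _)]
  exact Real.smoothTransition.le_one _

lemma eventually_radialCutoff_zero_eq (x : EuclideanSpace ℝ (Fin 2)) :
    ∀ᶠ n : ℕ in atTop, radialCutoff (n + 20000) 0 x =
      (ball (0 : EuclideanSpace ℝ (Fin 2)) 1).indicator 1 x := by
  by_cases hx : x ∈ ball (0 : EuclideanSpace ℝ (Fin 2)) 1
  · have hx1 := mem_ball_zero_iff.1 hx
    have hpos : 0 < 1 - ‖x‖ ^ 2 := by nlinarith [norm_nonneg x]
    filter_upwards [(tendsto_natCast_atTop_atTop.atTop_mul_const hpos).eventually_ge_atTop 1]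
      with n hn
    rw [indicator_of_mem hx, radialCutoff_of_one_le (by nlinarith), Pi.one_apply]
  · refine Eventually.of_forall fun n => ?_
    rw [indicator_of_notMem hx, radialCutoff_of_nonpos]
    rw [mem_ball_zero_iff, not_lt] at hx
    have hn : (0 : ℝ) ≤ n := n.cast_nonneg
    nlinarith [mul_nonneg (by linarith : (0 : ℝ) ≤ n + 20000)
      (by nlinarith : 0 ≤ ‖x‖ ^ 2 - 1)]

lemma eventually_radialCutoff_one_eq (x : EuclideanSpace ℝ (Fin 2)) :
    ∀ᶠ n : ℕ in atTop, radialCutoff (n + 20000) 1 x =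
      (closedBall (0 : EuclideanSpace ℝ (Fin 2)) 1).indicator 1 x := by
  by_cases hx : x ∈ closedBall (0 : EuclideanSpace ℝ (Fin 2)) 1
  · refine Eventually.of_forall fun n => ?_
    rw [indicator_of_mem hx, radialCutoff_of_one_le, Pi.one_apply]
    have hx1 := mem_closedBall_zero_iff.1 hx
    have hn : (0 : ℝ) ≤ n := n.cast_nonneg
    nlinarith [mul_nonneg (by linarith : (0 : ℝ) ≤ n + 20000)
      (by nlinarith [norm_nonneg x] : 0 ≤ 1 - ‖x‖ ^ 2)]
  · have hx1 : 1 < ‖x‖ := by simpa using hx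
    have hpos : 0 < ‖x‖ ^ 2 - 1 := by nlinarith
    filter_upwards [(tendsto_natCast_atTop_atTop.atTop_mul_const hpos).eventually_ge_atTop 1]
      with n hn
    rw [indicator_of_notMem hx, radialCutoff_of_nonpos (by nlinarith)]

/-- The second component of the derivative of the indicator of the perturbed annulus is negative
on the open unit ball and positive on the closed one. -/
theorem perturbedAnnulus_derivative_signs {νp νm : Measure (EuclideanSpace ℝ (Fin 2))}
    [IsFiniteMeasure νp] [IsFiniteMeasure νm]
    (h : ∀ φ : EuclideanSpace ℝ (Fin 2) → ℝ, ContDiff ℝ 1 φ → HasCompactSupport φ →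
      ∫ x in perturbedAnnulus, fderiv ℝ φ x (EuclideanSpace.single 1 1) ∂volume =
        (∫ x, φ x ∂νm) - (∫ x, φ x ∂νp)) :
    (νp (ball 0 1)).toReal < (νm (ball 0 1)).toReal ∧
      (νm (closedBall 0 1)).toReal < (νp (closedBall 0 1)).toReal := by
  have hn : ∀ n : ℕ, (20000 : ℝ) ≤ n + 20000 := fun n => by linarith [n.cast_nonneg (α := ℝ)]
  have htest : ∀ (n : ℕ) (k : ℝ), k ≤ 1 →
      (∫ x, radialCutoff (n + 20000) k x ∂νm) - (∫ x, radialCutoff (n + 20000) k x ∂νp) =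
        ∫ x in perturbedAnnulus, radialCutoffDeriv (n + 20000) k x := by
    intro n k hk
    rw [← h _ (contDiff_radialCutoff _ k)
      (hasCompactSupport_radialCutoff (by linarith [hn n]) hk)]
    simp only [fderiv_radialCutoff_single]
  constructor
  · have hlim := (tendsto_integral_radialCutoff νm measurableSet_ball
      eventually_radialCutoff_zero_eq).sub
      (tendsto_integral_radialCutoff νp measurableSet_ball eventually_radialCutoff_zero_eq)
    have := ge_of_tendsto' hlim fun n => (htest n 0 zero_le_one).symm ▸
      setIntegral_perturbedAnnulus_radialCutoffDeriv_zero (hn n)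
    linarith
  · have hlim := (tendsto_integral_radialCutoff νm measurableSet_closedBall
      eventually_radialCutoff_one_eq).sub
      (tendsto_integral_radialCutoff νp measurableSet_closedBall eventually_radialCutoff_one_eq)
    have := le_of_tendsto' hlim fun n => (htest n 1 le_rfl).symm ▸
      setIntegral_perturbedAnnulus_radialCutoffDeriv_one (hn n)
    linarith

end RadialCutoff

/-- for the perturbed annulus
`E = (E₀ \ B(c,δ²)) ∪ (B(c,δ²) \ B(0,1))`, `E₀ = B(0,1) \ B(0,1-δ)`, `δ = 0.01`,
`c = (0,1)`: for every `x ∈ B(0,δ)` the unique optimal ball is `B(0,1)` (so `M𝟙_E`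
is constant on `B(0,δ)`), while the second component `D₂𝟙_E = νp - νm` of the
distributional derivative satisfies `D₂𝟙_E(B(0,1)) < 0 < D₂𝟙_E(closure B(0,1))`. -/
theorem stmt15 (δ : ℝ) (hδ : δ = 0.01)
    (c : EuclideanSpace ℝ (Fin 2)) (hc : c = (EuclideanSpace.equiv (Fin 2) ℝ).symm ![0, 1])
    (E₀ E : Set (EuclideanSpace ℝ (Fin 2)))
    (hE₀ : E₀ = ball 0 1 \ ball 0 (1 - δ))
    (hE : E = (E₀ \ ball c (δ ^ 2)) ∪ (ball c (δ ^ 2) \ ball 0 1)) :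
    (∀ x ∈ ball (0 : EuclideanSpace ℝ (Fin 2)) δ,
      maxFnInd E x = volume (E ∩ ball 0 1) / volume (ball (0 : EuclideanSpace ℝ (Fin 2)) 1) ∧
      ∀ (z : EuclideanSpace ℝ (Fin 2)) (r : ℝ), 0 < r → x ∈ closedBall z r →
        volume (E ∩ ball z r) / volume (ball z r) = maxFnInd E x → z = 0 ∧ r = 1) ∧
    (∀ νp νm : Measure (EuclideanSpace ℝ (Fin 2)), IsFiniteMeasure νp → IsFiniteMeasure νm →
      (∀ φ : EuclideanSpace ℝ (Fin 2) → ℝ, ContDiff ℝ 1 φ → HasCompactSupport φ →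
        ∫ x in E, fderiv ℝ φ x (EuclideanSpace.single 1 1) ∂volume =
          (∫ x, φ x ∂νm) - (∫ x, φ x ∂νp)) →
      (νp (ball 0 1)).toReal < (νm (ball 0 1)).toReal ∧
      (νm (closedBall 0 1)).toReal < (νp (closedBall 0 1)).toReal) := by
  have hE' : E = perturbedAnnulus := by
    have hc' : c = northPole := hc
    rw [hE, hE₀, hc', hδ, perturbedAnnulus, thinAnnulus, poleDisc]
    norm_num
  clear hE
  subst hE' hδ
  refine ⟨fun x hx => ?_, fun νp νm hp hm h => perturbedAnnulus_derivative_signs h⟩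
  have hx' : ‖x‖ < 1 / 100 := by
    rw [mem_ball_zero_iff] at hx
    linarith
  refine ⟨maxFnInd_perturbedAnnulus hx', fun z r hr hxz h => ?_⟩
  by_contra hne
  rw [maxFnInd_perturbedAnnulus hx'] at h
  exact (perturbedAnnulus_ratio_lt hr hx' (mem_closedBall.1 hxz) hne).ne h
end
end
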